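/- arXiv:math/0608045 — 2 statements merged into one kernel-verified Lean document; each statement's English description precedes it below -/
import Mathlib

section
/- Let f be a complex polynomial of degree 3 which has a critical point c₀ belonging to the filled-in Julia set K_f, and such that every critical point of f other than c₀ lies outside K_f (i.e. has unbounded forward orbit). Then the Julia set J_f is a Cantor set if and only if the connected component K_f(c₀) of K_f containing c₀ is aperiodic, i.e. f^n(K_f(c₀)) ≠ K_f(c₀) for every integer n ≥ 1. -/
section

open Set Filter Topology Function MeasureTheory
open scoped ENNReal

/-! ### Components of open sets and of their preimages -/

theorem closure_connectedComponentIn_inter_subset {X : Type*} [TopologicalSpace X]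
    [LocallyConnectedSpace X] {Y : Set X} (hY : IsOpen Y) (x : X) :
    closure (connectedComponentIn Y x) ∩ Y ⊆ connectedComponentIn Y x := by
  rintro y ⟨hy, hyY⟩
  obtain ⟨w, hw, hw'⟩ := mem_closure_iff.1 hy _ hY.connectedComponentIn
    (mem_connectedComponentIn hyY)
  rw [connectedComponentIn_eq hw', ← connectedComponentIn_eq hw]
  exact mem_connectedComponentIn hyY

theorem frontier_connectedComponentIn_inter_eq_empty {X : Type*} [TopologicalSpace X]
    [LocallyConnectedSpace X] {Y : Set X} (hY : IsOpen Y) (x : X) :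
    frontier (connectedComponentIn Y x) ⊆ Yᶜ := by
  intro y hy hyY
  rw [hY.connectedComponentIn.frontier_eq] at hy
  exact hy.2 (closure_connectedComponentIn_inter_subset hY x ⟨hy.1, hyY⟩)

theorem image_connectedComponentIn_preimage {X Z : Type*} [TopologicalSpace X]
    [TopologicalSpace Z] [LocallyConnectedSpace X] {f : X → Z} (hc : Continuous f)
    (ho : IsOpenMap f) (hcl : IsClosedMap f) {U : Set Z} (hU : IsOpen U) {x : X}
    (hx : f x ∈ U) :
    f '' connectedComponentIn (f ⁻¹' U) x = connectedComponentIn U (f x) := by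
  have hY : IsOpen (f ⁻¹' U) := hU.preimage hc
  have hxQ : x ∈ connectedComponentIn (f ⁻¹' U) x := mem_connectedComponentIn hx
  apply Subset.antisymm
  · refine (isPreconnected_connectedComponentIn.image f
      hc.continuousOn).subset_connectedComponentIn ⟨x, hxQ, rfl⟩ ?_
    rintro _ ⟨y, hy, rfl⟩
    exact connectedComponentIn_subset (f ⁻¹' U) x hy
  · refine isPreconnected_connectedComponentIn.subset_of_closure_inter_subset
      (ho _ hY.connectedComponentIn) ⟨f x, mem_connectedComponentIn hx, x, hxQ, rfl⟩ ?_
    rintro w ⟨hw, hwP⟩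
    obtain ⟨y, hy, rfl⟩ := hcl.closure_image_subset _ hw
    exact ⟨y, closure_connectedComponentIn_inter_subset hY x
      ⟨hy, connectedComponentIn_subset U _ hwP⟩, rfl⟩

/-! ### Square roots of `z - a` on compact sets not surrounding `a` -/

theorem exists_sqrt_sub_of_norm_lt {L : Set ℂ} {a b : ℂ} {s : ℂ → ℂ} (hs : ContinuousOn s L)
    (hsq : ∀ z ∈ L, s z ^ 2 = z - a) (h : ∀ z ∈ L, ‖b - a‖ < ‖z - a‖) :
    ∃ t : ℂ → ℂ, ContinuousOn t L ∧ ∀ z ∈ L, t z ^ 2 = z - b := by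
  have hne : ∀ z ∈ L, z - a ≠ 0 := fun z hz h0 => by
    have := h z hz
    rw [h0, norm_zero] at this
    exact absurd this (not_lt.2 (norm_nonneg _))
  have hslit : ∀ z ∈ L, 1 - (b - a) / (z - a) ∈ Complex.slitPlane := fun z hz => by
    refine Complex.ball_one_subset_slitPlane ?_
    rw [Metric.mem_ball, dist_eq_norm, sub_sub_cancel_left, norm_neg, norm_div]
    exact (div_lt_one ((norm_nonneg _).trans_lt (h z hz))).2 (h z hz)
  refine ⟨fun z => s z * Complex.exp (Complex.log (1 - (b - a) / (z - a)) / 2), ?_, ?_⟩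
  · refine hs.mul (ContinuousOn.cexp (ContinuousOn.div_const (ContinuousOn.clog ?_ hslit) _))
    exact continuousOn_const.sub (continuousOn_const.div
      (continuousOn_id.sub continuousOn_const) hne)
  · intro z hz
    have h1 := hne z hz
    rw [mul_pow, hsq z hz, ← Complex.exp_nat_mul]
    have : ((2 : ℕ) : ℂ) * (Complex.log (1 - (b - a) / (z - a)) / 2)
        = Complex.log (1 - (b - a) / (z - a)) := by push_cast; ring
    rw [this, Complex.exp_log (Complex.slitPlane_ne_zero (hslit z hz))]
    field_simp
    ring

theorem exists_sqrt_sub_of_not_isBounded {L : Set ℂ} (hL : IsCompact L) {a : ℂ} (ha : a ∉ L)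
    (hW : ¬ Bornology.IsBounded (connectedComponentIn Lᶜ a)) :
    ∃ s : ℂ → ℂ, ContinuousOn s L ∧ ∀ z ∈ L, s z ^ 2 = z - a := by
  set S : Set ℂ := {b | b ∉ L ∧ ∃ s : ℂ → ℂ, ContinuousOn s L ∧ ∀ z ∈ L, s z ^ 2 = z - b}
    with hS
  have hpos : ∀ b ∉ L, ∃ δ > 0, ∀ z ∈ L, δ ≤ ‖z - b‖ := by
    intro b hb
    obtain ⟨δ, hδ, h⟩ := Metric.isOpen_iff.1 hL.isClosed.isOpen_compl b hb
    refine ⟨δ, hδ, fun z hz => ?_⟩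
    by_contra hlt
    exact h (by rw [Metric.mem_ball, dist_eq_norm]; exact not_le.1 hlt) hz
  have hSo : IsOpen S := by
    rw [Metric.isOpen_iff]
    rintro b ⟨hb, s, hs, hsq⟩
    obtain ⟨δ, hδ, h⟩ := hpos b hb
    refine ⟨δ, hδ, fun c hc => ?_⟩
    rw [Metric.mem_ball, dist_eq_norm] at hc
    refine ⟨fun hcL => ?_, exists_sqrt_sub_of_norm_lt hs hsq fun z hz => hc.trans_le (h z hz)⟩
    exact absurd (h c hcL) (not_le.2 hc)
  have hsub : connectedComponentIn Lᶜ a ⊆ S := by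
    refine isPreconnected_connectedComponentIn.subset_of_closure_inter_subset hSo ?_ ?_
    · obtain ⟨C, hC⟩ := hL.isBounded.exists_norm_le
      have : ∃ b ∈ connectedComponentIn Lᶜ a, max C 0 < ‖b‖ := by
        by_contra! hcon
        exact hW (isBounded_iff_forall_norm_le.2 ⟨_, hcon⟩)
      obtain ⟨b, hb, hbC⟩ := this
      have hbL : b ∉ L := connectedComponentIn_subset _ _ hb
      have hb0 : b ≠ 0 := norm_pos_iff.1 ((le_max_right _ _).trans_lt hbC)
      have hslit : ∀ z ∈ L, 1 - z / b ∈ Complex.slitPlane := fun z hz => by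
        refine Complex.ball_one_subset_slitPlane ?_
        rw [Metric.mem_ball, dist_eq_norm, sub_sub_cancel_left, norm_neg, norm_div]
        exact (div_lt_one (norm_pos_iff.2 hb0)).2
          ((hC z hz).trans_lt ((le_max_left _ _).trans_lt hbC))
      obtain ⟨β, hβ⟩ := IsAlgClosed.exists_pow_nat_eq (-b) (n := 2) two_pos
      refine ⟨b, hb, hbL, fun z => β * Complex.exp (Complex.log (1 - z / b) / 2), ?_, ?_⟩
      · refine continuousOn_const.mul (ContinuousOn.cexp
          (ContinuousOn.div_const (ContinuousOn.clog ?_ hslit) _))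
        exact continuousOn_const.sub (continuousOn_id.div_const _)
      · intro z hz
        rw [mul_pow, hβ, ← Complex.exp_nat_mul]
        have : ((2 : ℕ) : ℂ) * (Complex.log (1 - z / b) / 2) = Complex.log (1 - z / b) := by
          push_cast; ring
        rw [this, Complex.exp_log (Complex.slitPlane_ne_zero (hslit z hz))]
        field_simp
        ring
    · rintro b ⟨hbS, hbW⟩
      have hbL : b ∉ L := connectedComponentIn_subset _ _ hbW
      obtain ⟨δ, hδ, h⟩ := hpos b hbL
      obtain ⟨c, ⟨hcL, s, hs, hsq⟩, hcb⟩ := Metric.mem_closure_iff.1 hbS (δ / 2) (half_pos hδ)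
      refine ⟨hbL, exists_sqrt_sub_of_norm_lt hs hsq fun z hz => ?_⟩
      rw [dist_eq_norm] at hcb
      have h1 := h z hz
      have h2 : ‖z - b‖ ≤ ‖z - c‖ + ‖b - c‖ := by
        have := norm_sub_le (z - c) (b - c)
        rwa [sub_sub_sub_cancel_right] at this
      linarith
  exact (hsub (mem_connectedComponentIn ha)).2

theorem norm_le_on_connectedComponentIn_compl {L : Set ℂ} (hL : IsCompact L) {a : ℂ}
    (hW : Bornology.IsBounded (connectedComponentIn Lᶜ a)) {F : ℂ → ℂ}
    (hF : Differentiable ℂ F) {r : ℝ} (hr : ∀ z ∈ L, ‖F z‖ ≤ r) :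
    ∀ z ∈ closure (connectedComponentIn Lᶜ a), ‖F z‖ ≤ r := by
  refine fun z hz => Complex.norm_le_of_forall_mem_frontier_norm_le hW hF.diffContOnCl ?_ hz
  intro w hw
  exact hr w (not_notMem.1
    (frontier_connectedComponentIn_inter_eq_empty hL.isClosed.isOpen_compl a hw))

/-- A point outside the polynomial hull of `L` is not surrounded by `L`. -/
theorem exists_sqrt_sub_of_norm_le {L : Set ℂ} (hL : IsCompact L) {F : ℂ → ℂ}
    (hF : Differentiable ℂ F) {r : ℝ} (hr : ∀ z ∈ L, ‖F z‖ ≤ r) {a : ℂ} (ha : r < ‖F a‖) :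
    ∃ s : ℂ → ℂ, ContinuousOn s L ∧ ∀ z ∈ L, s z ^ 2 = z - a := by
  have haL : a ∉ L := fun h => absurd (hr a h) (not_le.2 ha)
  refine exists_sqrt_sub_of_not_isBounded hL haL fun hb => ?_
  exact absurd (norm_le_on_connectedComponentIn_compl hL hb hF hr a
    (subset_closure (mem_connectedComponentIn haL))) (not_le.2 ha)

/-- Components of sublevel sets of `‖F‖` are full. -/
theorem exists_sqrt_sub_of_subset_component {L : Set ℂ} (hL : IsCompact L) {F : ℂ → ℂ}
    (hF : Differentiable ℂ F) {R : ℝ} {z₀ : ℂ}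
    (hsub : L ⊆ connectedComponentIn {z | ‖F z‖ < R} z₀) {a : ℂ}
    (ha : a ∉ connectedComponentIn {z | ‖F z‖ < R} z₀) :
    ∃ s : ℂ → ℂ, ContinuousOn s L ∧ ∀ z ∈ L, s z ^ 2 = z - a := by
  have haL : a ∉ L := fun h => ha (hsub h)
  refine exists_sqrt_sub_of_not_isBounded hL haL fun hb => ha ?_
  have haW : a ∈ connectedComponentIn Lᶜ a := mem_connectedComponentIn haL
  have hfr : (frontier (connectedComponentIn Lᶜ a)).Nonempty := by
    refine nonempty_frontier_iff.2 ⟨⟨a, haW⟩, fun hu => ?_⟩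
    rw [hu] at hb
    exact NormedSpace.unbounded_univ ℝ ℂ hb
  obtain ⟨x, hx⟩ := hfr
  have hxL : x ∈ L := not_notMem.1
    (frontier_connectedComponentIn_inter_eq_empty hL.isClosed.isOpen_compl a hx)
  obtain ⟨m, hm, hmax⟩ := hL.exists_isMaxOn ⟨x, hxL⟩ hF.continuous.norm.continuousOn
  have hmR : m ∈ {z | ‖F z‖ < R} := connectedComponentIn_subset _ _ (hsub hm)
  have hle := norm_le_on_connectedComponentIn_compl hL hb hF (r := ‖F m‖) fun z hz => hmax hz
  have h1 : closure (connectedComponentIn Lᶜ a) ⊆ connectedComponentIn {z | ‖F z‖ < R} x :=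
    isPreconnected_connectedComponentIn.closure.subset_connectedComponentIn
      (frontier_subset_closure hx) fun z hz => (hle z hz).trans_lt hmR
  rw [connectedComponentIn_eq (hsub hxL)]
  exact h1 (subset_closure haW)

/-! ### Injectivity of unramified proper maps -/

theorem exists_isOpen_injOn_of_deriv_ne_zero {f : ℂ → ℂ} (hf : Differentiable ℂ f) {z : ℂ}
    (hz : deriv f z ≠ 0) : ∃ O : Set ℂ, IsOpen O ∧ z ∈ O ∧ InjOn f O := by
  have h : HasStrictDerivAt f (deriv f z) z :=
    (hf.analyticAt z).contDiffAt.hasStrictDerivAt (n := 1) one_ne_zero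
  have h' := h.hasStrictFDerivAt_equiv hz
  refine ⟨(h'.toOpenPartialHomeomorph f).source, (h'.toOpenPartialHomeomorph f).open_source,
    h'.mem_toOpenPartialHomeomorph_source, ?_⟩
  exact (h'.toOpenPartialHomeomorph f).injOn

theorem injOn_of_unramified {f : ℂ → ℂ} (hf : Differentiable ℂ f) (ho : IsOpenMap f)
    {X B : Set ℂ} (hX : IsPreconnected X) (hB : IsOpen B) (hBb : Bornology.IsBounded B)
    (hcl : closure B ∩ f ⁻¹' X ⊆ B) (hd : ∀ z ∈ B, deriv f z ≠ 0) (hBX : B ⊆ f ⁻¹' X)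
    {w₀ : ℂ} (hw₀ : w₀ ∈ X) (hone : (B ∩ f ⁻¹' {w₀}).Subsingleton) : InjOn f B := by
  set M : Set ℂ := {w | ∃ z ∈ B, ∃ z' ∈ B, z ≠ z' ∧ f z = w ∧ f z' = w} with hM
  by_contra hinj
  have hMne : (X ∩ M).Nonempty := by
    simp only [InjOn, not_forall] at hinj
    obtain ⟨z, hz, z', hz', h, hne⟩ := hinj
    exact ⟨f z, hBX hz, z, hz, z', hz', hne, rfl, h.symm⟩
  have hMo : IsOpen M := by
    rw [isOpen_iff_mem_nhds]
    rintro w ⟨z, hz, z', hz', hne, hzw, hzw'⟩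
    obtain ⟨O, O', hO, hO', hzO, hzO', hd⟩ := t2_separation hne
    have h1 : f '' (O ∩ B) ∈ 𝓝 w :=
      (ho _ (hO.inter hB)).mem_nhds ⟨z, ⟨hzO, hz⟩, hzw⟩
    have h2 : f '' (O' ∩ B) ∈ 𝓝 w :=
      (ho _ (hO'.inter hB)).mem_nhds ⟨z', ⟨hzO', hz'⟩, hzw'⟩
    filter_upwards [h1, h2] with v hv hv'
    obtain ⟨y, hy, hyv⟩ := hv
    obtain ⟨y', hy', hyv'⟩ := hv'
    exact ⟨y, hy.2, y', hy'.2, fun h => disjoint_left.1 hd hy.1 (h ▸ hy'.1), hyv, hyv'⟩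
  have hsub : X ⊆ M := by
    refine hX.subset_of_closure_inter_subset hMo hMne ?_
    rintro w ⟨hw, hwX⟩
    obtain ⟨u, hu, huw⟩ := mem_closure_iff_seq_limit.1 hw
    choose z hz z' hz' hne hzu hzu' using hu
    have hK : IsCompact (closure B) := hBb.isCompact_closure
    obtain ⟨p, hp, φ, hφ, hlim⟩ := (hK.prod hK).tendsto_subseq (x := fun n => (z n, z' n))
      fun n => ⟨subset_closure (hz n), subset_closure (hz' n)⟩
    have hl1 : Tendsto (fun n => z (φ n)) atTop (𝓝 p.1) :=
      (continuous_fst.tendsto p).comp hlim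
    have hl2 : Tendsto (fun n => z' (φ n)) atTop (𝓝 p.2) :=
      (continuous_snd.tendsto p).comp hlim
    have hu' := huw.comp hφ.tendsto_atTop
    have e1 : f p.1 = w := by
      refine tendsto_nhds_unique ((hf.continuous.tendsto _).comp hl1) ?_
      simpa [Function.comp_def, hzu] using hu'
    have e2 : f p.2 = w := by
      refine tendsto_nhds_unique ((hf.continuous.tendsto _).comp hl2) ?_
      simpa [Function.comp_def, hzu'] using hu'
    have hp1 : p.1 ∈ B := hcl ⟨hp.1, by rwa [mem_preimage, e1]⟩
    have hp2 : p.2 ∈ B := hcl ⟨hp.2, by rwa [mem_preimage, e2]⟩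
    refine ⟨p.1, hp1, p.2, hp2, fun heq => ?_, e1, e2⟩
    obtain ⟨O, hO, hpO, hinjO⟩ := exists_isOpen_injOn_of_deriv_ne_zero hf (hd _ hp1)
    obtain ⟨n, hn1, hn2⟩ := ((hl1.eventually (hO.mem_nhds hpO)).and
      (hl2.eventually (hO.mem_nhds (heq ▸ hpO)))).exists
    exact hne _ (hinjO hn1 hn2 ((hzu _).trans (hzu' _).symm))
  obtain ⟨z, hz, z', hz', hne, h1, h2⟩ := hsub hw₀
  exact hne (hone ⟨hz, h1⟩ ⟨hz', h2⟩)

theorem isCompact_norm_le {F : ℂ → ℂ} (hc : Continuous F)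
    (ht : Tendsto (fun z => ‖F z‖) (cocompact ℂ) atTop) (r : ℝ) :
    IsCompact {z | ‖F z‖ ≤ r} := by
  refine Metric.isCompact_of_isClosed_isBounded
    (isClosed_le hc.norm continuous_const) ?_
  have h := ht.eventually (eventually_gt_atTop r)
  rw [← Metric.cobounded_eq_cocompact] at h
  rw [Bornology.isBounded_def]
  filter_upwards [h] with z hz
  simpa using hz

/-- Near a noncritical boundary point, a sublevel set of `‖F‖` is connected, so two relatively
clopen parts cannot both accumulate there. -/
theorem not_mem_closure_of_deriv_ne_zero {F : ℂ → ℂ} (hF : Differentiable ℂ F) {r : ℝ}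
    {z₁ p : ℂ} (hp : deriv F p ≠ 0)
    (h₁ : p ∈ closure (connectedComponentIn {z | ‖F z‖ < r} z₁)) :
    p ∉ closure ({z | ‖F z‖ < r} \ connectedComponentIn {z | ‖F z‖ < r} z₁) := by
  intro h₂
  have h : HasStrictDerivAt F (deriv F p) p :=
    (hF.analyticAt p).contDiffAt.hasStrictDerivAt (n := 1) one_ne_zero
  set e := (h.hasStrictFDerivAt_equiv hp).toOpenPartialHomeomorph F with he
  have hpe : p ∈ e.source := (h.hasStrictFDerivAt_equiv hp).mem_toOpenPartialHomeomorph_source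
  have hee : ∀ z, e z = F z := fun z => rfl
  obtain ⟨δ, hδ, hball⟩ := Metric.isOpen_iff.1 e.open_target (F p) (e.map_source hpe)
  set O := e.source ∩ e ⁻¹' Metric.ball (F p) δ with hO
  have hOo : IsOpen O := e.isOpen_inter_preimage Metric.isOpen_ball
  have hpO : p ∈ O := ⟨hpe, Metric.mem_ball_self hδ⟩
  set D := Metric.ball (F p) δ ∩ Metric.ball (0:ℂ) r with hD
  have hDp : IsPreconnected (e.symm '' D) := by
    refine IsPreconnected.image ?_ _ (e.continuousOn_symm.mono fun w hw => hball hw.1)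
    exact ((convex_ball _ _).inter (convex_ball _ _)).isPreconnected
  have hDY : e.symm '' D ⊆ {z | ‖F z‖ < r} := by
    rintro _ ⟨w, hw, rfl⟩
    have : F (e.symm w) = w := e.right_inv (hball hw.1)
    simpa [this] using hw.2
  have key : ∀ x ∈ O, ‖F x‖ < r → x ∈ e.symm '' D := fun x hx hxr =>
    ⟨F x, ⟨hx.2, by simpa using hxr⟩, e.left_inv hx.1⟩
  obtain ⟨x₁, hx₁O, hx₁⟩ := mem_closure_iff.1 h₁ O hOo hpO
  obtain ⟨x₂, hx₂O, hx₂⟩ := mem_closure_iff.1 h₂ O hOo hpO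
  apply hx₂.2
  rw [connectedComponentIn_eq hx₁]
  have hx₁Y : x₁ ∈ {z | ‖F z‖ < r} := connectedComponentIn_subset _ _ hx₁
  exact hDp.subset_connectedComponentIn (key x₁ hx₁O hx₁Y) hDY
    (key x₂ hx₂O hx₂.1)

theorem exists_zero_mem_connectedComponentIn {F : ℂ → ℂ} (hc : Continuous F)
    (ho : IsOpenMap F) (hcl : IsClosedMap F) {r : ℝ} {x : ℂ} (hx : ‖F x‖ < r) :
    ∃ z ∈ connectedComponentIn {z | ‖F z‖ < r} x, F z = 0 := by
  have h := image_connectedComponentIn_preimage hc ho hcl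
    (U := Metric.ball (0:ℂ) r) Metric.isOpen_ball (x := x) (by simpa using hx)
  have h2 : connectedComponentIn (Metric.ball (0:ℂ) r) (F x) = Metric.ball 0 r :=
    (convex_ball _ _).isPreconnected.connectedComponentIn (by simpa using hx)
  have h0 : (0:ℂ) ∈ Metric.ball (0:ℂ) r := Metric.mem_ball_self ((norm_nonneg _).trans_lt hx)
  rw [h2] at h
  rw [← h] at h0
  have h3 : F ⁻¹' Metric.ball (0:ℂ) r = {z | ‖F z‖ < r} := by ext; simp
  rwa [h3] at h0

theorem isPreconnected_norm_lt {F : ℂ → ℂ} (hF : Differentiable ℂ F) (ho : IsOpenMap F)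
    (hcl : IsClosedMap F) (ht : Tendsto (fun z => ‖F z‖) (cocompact ℂ) atTop) {R : ℝ}
    (hR : 0 < R) (hd : ∀ z, R ≤ ‖F z‖ → deriv F z ≠ 0) :
    IsPreconnected {z | ‖F z‖ < R} := by
  have hc := hF.continuous
  have hYo : ∀ r : ℝ, IsOpen {z | ‖F z‖ < r} := fun r => isOpen_lt hc.norm continuous_const
  suffices hz : ∀ z₁ z₂ : ℂ, F z₁ = 0 → F z₂ = 0 →
      z₂ ∈ connectedComponentIn {z | ‖F z‖ < R} z₁ by
    rcases Set.eq_empty_or_nonempty {z | ‖F z‖ < R} with h | ⟨x, hx⟩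
    · rw [h]; exact isPreconnected_empty
    obtain ⟨z₁, hz₁, hz₁'⟩ := exists_zero_mem_connectedComponentIn hc ho hcl hx
    have : connectedComponentIn {z | ‖F z‖ < R} z₁ = {z | ‖F z‖ < R} := by
      refine (connectedComponentIn_subset _ _).antisymm fun y hy => ?_
      obtain ⟨z₂, hz₂, hz₂'⟩ := exists_zero_mem_connectedComponentIn hc ho hcl hy
      rw [connectedComponentIn_eq (hz z₁ z₂ hz₁' hz₂'), ← connectedComponentIn_eq hz₂]
      exact mem_connectedComponentIn hy
    rw [← this]
    exact isPreconnected_connectedComponentIn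
  intro z₁ z₂ h₁ h₂
  set T : Set ℝ := {r | 0 < r ∧ z₂ ∈ connectedComponentIn {z | ‖F z‖ < r} z₁} with hT
  have hmem : ∀ {r : ℝ}, 0 < r → z₁ ∈ {z | ‖F z‖ < r} := fun hr => by simpa [h₁] using hr
  have hup : ∀ r ∈ T, ∀ r', r ≤ r' → r' ∈ T := fun r hr r' h =>
    ⟨hr.1.trans_le h, connectedComponentIn_mono _ (fun z hz => lt_of_lt_of_le hz h) hr.2⟩
  have hne : T.Nonempty := by
    have hk : IsCompact (segment ℝ z₁ z₂) := by
      rw [segment_eq_image]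
      exact isCompact_Icc.image (by fun_prop)
    obtain ⟨C, hC⟩ := hk.exists_bound_of_continuousOn hc.continuousOn
    have hC0 : 0 ≤ C := (norm_nonneg _).trans (hC _ (left_mem_segment ℝ z₁ z₂))
    refine ⟨C + 1, by linarith, ?_⟩
    exact (convex_segment z₁ z₂).isPreconnected.subset_connectedComponentIn
      (left_mem_segment ℝ z₁ z₂) (fun z hz => by
        have := hC z hz
        show ‖F z‖ < C + 1
        linarith) (right_mem_segment ℝ z₁ z₂)
  have hbdd : BddBelow T := ⟨0, fun r hr => hr.1.le⟩
  have hopen : ∀ r ∈ T, ∃ r' ∈ T, r' < r := by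
    rintro r ⟨hr, hr2⟩
    have hpc : IsPathConnected (connectedComponentIn {z | ‖F z‖ < r} z₁) :=
      ((hYo r).connectedComponentIn.isConnected_iff_isPathConnected).1
        (isConnected_connectedComponentIn_iff.2 (hmem hr))
    obtain ⟨γ, hγ⟩ := hpc.joinedIn _ (mem_connectedComponentIn (hmem hr)) _ hr2
    obtain ⟨t, -, ht⟩ := isCompact_univ.exists_isMaxOn univ_nonempty
      ((hc.comp γ.continuous).norm.continuousOn (s := univ))
    have hlt : γ t ∈ {z | ‖F z‖ < r} := connectedComponentIn_subset _ _ (hγ t)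
    replace hlt : ‖F (γ t)‖ < r := hlt
    have h0 : 0 ≤ ‖F (γ t)‖ := norm_nonneg _
    refine ⟨(‖F (γ t)‖ + r) / 2, ⟨by linarith, ?_⟩, by linarith⟩
    have hpre : IsPreconnected (range γ) := isPreconnected_range γ.continuous
    refine hpre.subset_connectedComponentIn ⟨0, γ.source⟩ ?_ ⟨1, γ.target⟩
    rintro _ ⟨s, rfl⟩
    have : ‖F (γ s)‖ ≤ ‖F (γ t)‖ := ht (mem_univ s)
    show ‖F (γ s)‖ < _
    linarith
  by_contra hRT
  have hlow : ∀ r ∈ T, R ≤ r := fun r hr => by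
    by_contra! h
    exact hRT (hup r hr R h.le).2
  set r₀ := sInf T with hr₀
  have hRr : R ≤ r₀ := le_csInf hne hlow
  have hr₀0 : 0 < r₀ := hR.trans_le hRr
  have hr₀T : r₀ ∉ T := fun h => by
    obtain ⟨r', hr', hlt⟩ := hopen r₀ h
    exact absurd (csInf_le hbdd hr') (not_le.2 hlt)
  have hgt : ∀ r, r₀ < r → r ∈ T := fun r hr => by
    obtain ⟨r', hr', hlt⟩ := exists_lt_of_csInf_lt hne hr
    exact hup r' hr' r hlt.le
  set Y := {z | ‖F z‖ < r₀} with hY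
  set Ω := connectedComponentIn Y z₁ with hΩ
  have hΩo : IsOpen Ω := (hYo r₀).connectedComponentIn
  have hcY : closure Y ⊆ {z | ‖F z‖ ≤ r₀} :=
    closure_minimal (fun z (hz : ‖F z‖ < r₀) => show ‖F z‖ ≤ r₀ from hz.le)
      (isClosed_le hc.norm continuous_const)
  have hdis : Disjoint (closure Ω) (closure (Y \ Ω)) := by
    rw [Set.disjoint_left]
    intro p hp1 hp2
    have hpr : ‖F p‖ ≤ r₀ := hcY (closure_mono (connectedComponentIn_subset _ _) hp1)
    rcases lt_or_eq_of_le hpr with hlt | heq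
    · have hpΩ : p ∈ Ω := closure_connectedComponentIn_inter_subset (hYo r₀) z₁ ⟨hp1, hlt⟩
      obtain ⟨x, hx, hx'⟩ := mem_closure_iff.1 hp2 Ω hΩo hpΩ
      exact hx'.2 hx
    · exact not_mem_closure_of_deriv_ne_zero hF (hd p (heq ▸ hRr)) hp1 hp2
  have hk := isCompact_norm_le hc ht
  have hk1 : IsCompact (closure Ω) := (hk r₀).of_isClosed_subset isClosed_closure
    ((closure_mono (connectedComponentIn_subset _ _)).trans hcY)
  have hk2 : IsCompact (closure (Y \ Ω)) := (hk r₀).of_isClosed_subset isClosed_closure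
    ((closure_mono sdiff_subset).trans hcY)
  obtain ⟨O₁, O₂, hO₁, hO₂, hs₁, hs₂, hO⟩ := SeparatedNhds.of_isCompact_isCompact hk1 hk2 hdis
  have hcover : {z | ‖F z‖ ≤ r₀} ⊆ O₁ ∪ O₂ := by
    have h1 : {z | ‖F z‖ ≤ r₀} ⊆ closure Y := by
      intro z hz
      have h2 : F z ∈ closure (Metric.ball (0:ℂ) r₀) := by
        rw [closure_ball _ hr₀0.ne']; simpa using hz
      rw [hY]
      have h3 := ho.preimage_closure_subset_closure_preimage (s := Metric.ball (0:ℂ) r₀) h2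
      convert h3 using 2
      ext; simp
    refine h1.trans ?_
    have : Y ⊆ Ω ∪ (Y \ Ω) := fun z hz => by
      by_cases h : z ∈ Ω
      · exact Or.inl h
      · exact Or.inr ⟨hz, h⟩
    refine (closure_mono this).trans ?_
    rw [closure_union]
    exact union_subset_union hs₁ hs₂
  have hex : ∃ r > r₀, {z | ‖F z‖ < r} ⊆ O₁ ∪ O₂ := by
    have hck : IsCompact ({z | ‖F z‖ ≤ r₀ + 1} \ (O₁ ∪ O₂)) :=
      (hk _).diff (hO₁.union hO₂)
    rcases Set.eq_empty_or_nonempty ({z | ‖F z‖ ≤ r₀ + 1} \ (O₁ ∪ O₂)) with he | hne'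
    · refine ⟨r₀ + 1, by simp, fun z hz => ?_⟩
      exact sdiff_eq_empty.1 he (show ‖F z‖ ≤ r₀ + 1 from le_of_lt hz)
    · obtain ⟨m, hm, hmin⟩ := hck.exists_isMinOn hne' hc.norm.continuousOn
      have hmr : r₀ < ‖F m‖ := by
        by_contra! h
        exact hm.2 (hcover h)
      refine ⟨‖F m‖, hmr, fun z hz => ?_⟩
      by_contra hzO
      have : ‖F m‖ ≤ ‖F z‖ := hmin ⟨show ‖F z‖ ≤ r₀ + 1 from
        (le_of_lt (show ‖F z‖ < ‖F m‖ from hz)).trans hm.1, hzO⟩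
      exact absurd hz (not_lt.2 this)
  obtain ⟨r, hr, hrO⟩ := hex
  have hrT := (hgt r hr).2
  have hz₁O : z₁ ∈ O₁ := hs₁ (subset_closure (mem_connectedComponentIn (hmem hr₀0)))
  have hz₂O : z₂ ∈ O₂ := hs₂ (subset_closure ⟨by simpa [hY, h₂] using hr₀0,
    fun h => hr₀T ⟨hr₀0, h⟩⟩)
  obtain ⟨x, -, hx⟩ := isPreconnected_connectedComponentIn O₁ O₂ hO₁ hO₂
    ((connectedComponentIn_subset _ z₁).trans hrO)
    ⟨z₁, mem_connectedComponentIn (hmem (hr₀0.trans hr)), hz₁O⟩ ⟨z₂, hrT, hz₂O⟩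
  exact Set.disjoint_left.1 hO hx.1 hx.2

/-- Principal square root. -/
noncomputable def principalSqrt (z : ℂ) : ℂ := Complex.exp (Complex.log z / 2)

theorem principalSqrt_sq {z : ℂ} (hz : z ≠ 0) : principalSqrt z ^ 2 = z := by
  rw [principalSqrt, ← Complex.exp_nat_mul]
  convert Complex.exp_log hz using 2
  push_cast; ring

theorem principalSqrt_ne_zero (z : ℂ) : principalSqrt z ≠ 0 := Complex.exp_ne_zero _

theorem continuousOn_principalSqrt_comp {g : ℂ → ℂ} {S : Set ℂ} (hg : ContinuousOn g S)
    (h : ∀ z ∈ S, g z ∈ Complex.slitPlane) : ContinuousOn (fun z => principalSqrt (g z)) S :=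
  Complex.continuous_exp.comp_continuousOn ((hg.clog h).div_const 2)

theorem principalSqrt_I : principalSqrt Complex.I = Complex.I * principalSqrt (-Complex.I) := by
  have h : Complex.I = Complex.exp (Real.pi / 2 * Complex.I) := by
    rw [Complex.exp_pi_div_two_mul_I]
  rw [principalSqrt, principalSqrt, Complex.log_I, Complex.log_neg_I]
  generalize hx : Complex.exp (-(Real.pi / 2) * Complex.I / 2) = x
  calc Complex.exp (Real.pi / 2 * Complex.I / 2)
      = Complex.exp (Real.pi / 2 * Complex.I) * x := by
        rw [← hx, ← Complex.exp_add]
        congr 1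
        ring
    _ = Complex.I * x := by rw [← h]

/-- Two continuous square roots of the same nonvanishing function on a preconnected set have the
same ratio of values at any two points. -/
theorem mul_eq_mul_of_sq_eq {S : Set ℂ} (hS : IsPreconnected S) {s t : ℂ → ℂ}
    (hs : ContinuousOn s S) (ht : ContinuousOn t S) (hne : ∀ z ∈ S, t z ≠ 0)
    (h : ∀ z ∈ S, s z ^ 2 = t z ^ 2) {p q : ℂ} (hp : p ∈ S) (hq : q ∈ S) :
    s p * t q = s q * t p := by
  rcases hS.eq_or_eq_neg_of_sq_eq hs ht (fun z hz => h z hz) (fun {z} hz => hne z hz) with h' | h'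
  · rw [h' hp, h' hq]; ring
  · rw [h' hp, h' hq]; simp [mul_comm]

theorem exists_saddle_cross {F h : ℂ → ℂ} {c : ℂ} (hh : ContinuousAt h c) (hc : h c ≠ 0)
    (hFc : F c ≠ 0) (hFh : ∀ z, F z = F c + (z - c) ^ 2 * h z) :
    ∃ b : ℂ, b ≠ 0 ∧ ∀ t : ℝ, |t| ≤ 1 → t ≠ 0 →
      ‖F c‖ < ‖F (c + t * b)‖ ∧ ‖F (c + t * b * Complex.I)‖ < ‖F c‖ := by
  obtain ⟨η, hη⟩ := IsAlgClosed.exists_pow_nat_eq (F c / h c) (n := 2) (by norm_num)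
  have hη0 : η ≠ 0 := by
    rintro rfl
    rw [eq_comm, zero_pow two_ne_zero, div_eq_zero_iff] at hη
    tauto
  have h1 : ContinuousAt (fun z => h z / h c) c := hh.div_const _
  obtain ⟨δ, hδ, hδ'⟩ := Metric.continuousAt_iff.1 h1 (1/2) (by norm_num)
  have hη' : 0 < ‖η‖ := norm_pos_iff.2 hη0
  set ε : ℝ := min 1 (δ / 2 / ‖η‖) with hε
  have hε0 : 0 < ε := lt_min one_pos (by positivity)
  have hε1 : ε ≤ 1 := min_le_left _ _
  have hε2 : ε * ‖η‖ < δ := by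
    have : ε * ‖η‖ ≤ δ / 2 := (le_div_iff₀ hη').1 (min_le_right _ _)
    linarith
  have hw : ∀ u : ℂ, ‖u‖ ≤ ε * ‖η‖ → ‖h (c + u) / h c - 1‖ < 1 / 2 := by
    intro u hu
    have := hδ' (x := c + u) (by rw [dist_eq_norm, add_sub_cancel_left]; linarith)
    rwa [dist_eq_norm, div_self hc] at this
  have hFu : ∀ u : ℂ, F (c + u) = F c * (1 + (u / η) ^ 2 * (h (c + u) / h c)) := by
    intro u
    rw [hFh (c + u), div_pow, hη]
    field_simp
    ring
  have hFn : 0 < ‖F c‖ := norm_pos_iff.2 hFc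
  refine ⟨ε * η, by simp [hη0, hε0.ne'], fun t ht ht0 => ?_⟩
  have hx0 : 0 < (t * ε) ^ 2 := by positivity
  have hx1 : (t * ε) ^ 2 ≤ 1 := by
    rw [sq_le_one_iff_abs_le_one, abs_mul, abs_of_pos hε0]
    nlinarith [abs_nonneg t]
  have hn : ‖(t * (ε * η) : ℂ)‖ ≤ ε * ‖η‖ := by
    simp only [norm_mul, Complex.norm_real, Real.norm_eq_abs, abs_of_pos hε0]
    exact mul_le_of_le_one_left (by positivity) ht
  constructor
  · rw [hFu, norm_mul]
    refine lt_mul_of_one_lt_right hFn ?_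
    have h2 := hw _ hn
    set w := h (c + t * (ε * η)) / h c
    have h3 : ((t * (ε * η) : ℂ) / η) ^ 2 = (((t * ε) ^ 2 : ℝ) : ℂ) := by
      push_cast; field_simp
    rw [h3]
    refine lt_of_lt_of_le ?_ (Complex.re_le_norm _)
    have h4 := (abs_le.1 (Complex.abs_re_le_norm (w - 1))).1
    rw [Complex.add_re, Complex.re_ofReal_mul, Complex.one_re]
    rw [Complex.sub_re, Complex.one_re] at h4
    nlinarith
  · rw [hFu, norm_mul]
    refine mul_lt_of_lt_one_right hFn ?_
    have h2 := hw (t * (ε * η) * Complex.I) (by rw [norm_mul, Complex.norm_I, mul_one]; exact hn)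
    set w := h (c + t * (ε * η) * Complex.I) / h c
    have h3 : ((t * (ε * η) * Complex.I : ℂ) / η) ^ 2 = - (((t * ε) ^ 2 : ℝ) : ℂ) := by
      push_cast; field_simp; simp
    rw [h3]
    have h4 : 1 + -(((t * ε) ^ 2 : ℝ) : ℂ) * w
        = ((1 - (t * ε) ^ 2 : ℝ) : ℂ) - (((t * ε) ^ 2 : ℝ) : ℂ) * (w - 1) := by
      push_cast; ring
    rw [h4]
    refine (norm_sub_le _ _).trans_lt ?_
    rw [norm_mul, Complex.norm_real, Complex.norm_real, Real.norm_of_nonneg (by linarith),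
      Real.norm_of_nonneg hx0.le]
    nlinarith

/-- The sublevel set of `‖F‖` at a nondegenerate critical value is disconnected. -/
theorem not_isPreconnected_of_critical {F h : ℂ → ℂ} (hF : Differentiable ℂ F) {c : ℂ}
    (hh : ContinuousAt h c) (hc : h c ≠ 0) (hFc : F c ≠ 0)
    (hFh : ∀ z, F z = F c + (z - c) ^ 2 * h z) :
    ¬ IsPreconnected {z | ‖F z‖ < ‖F c‖} := by
  intro hpre
  obtain ⟨b, hb0, hb⟩ := exists_saddle_cross hh hc hFc hFh
  set V := {z | ‖F z‖ < ‖F c‖} with hV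
  have hVo : IsOpen V := isOpen_lt hF.continuous.norm continuous_const
  have hpV : c + b * Complex.I ∈ V := by
    show ‖F (c + b * Complex.I)‖ < ‖F c‖
    simpa using (hb 1 (by simp) one_ne_zero).2
  have hqV : c - b * Complex.I ∈ V := by
    have := (hb (-1) (by simp) (by simp)).2
    show ‖F (c - b * Complex.I)‖ < ‖F c‖
    simpa [← sub_eq_add_neg] using this
  have hpc : IsPathConnected V := (hVo.isConnected_iff_isPathConnected).1 ⟨⟨_, hpV⟩, hpre⟩
  obtain ⟨γ, hγ⟩ := hpc.joinedIn _ hpV _ hqV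
  set E : Set ℂ := (fun t : ℝ => c + t * b * Complex.I) '' Icc (-1) 1 with hE
  have hEc : IsCompact E := isCompact_Icc.image (by fun_prop)
  have hEp : IsPreconnected E := isPreconnected_Icc.image _ (by fun_prop)
  have hpE : c + b * Complex.I ∈ E := ⟨1, by simp, by simp⟩
  have hqE : c - b * Complex.I ∈ E := ⟨-1, by simp, by simp [sub_eq_add_neg]⟩
  have hGp : IsPreconnected (range γ) := isPreconnected_range γ.continuous
  have hpG : c + b * Complex.I ∈ range γ := ⟨0, γ.source⟩
  have hqG : c - b * Complex.I ∈ range γ := ⟨1, γ.target⟩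
  set L := range γ ∪ E with hL
  have hLc : IsCompact L := (isCompact_range γ.continuous).union hEc
  have hLF : ∀ z ∈ L, ‖F z‖ ≤ ‖F c‖ := by
    rintro z (⟨t, rfl⟩ | ⟨t, ht, rfl⟩)
    · exact (show ‖F (γ t)‖ < ‖F c‖ from hγ t).le
    · rcases eq_or_ne t 0 with rfl | h0
      · simp
      · exact (hb t (abs_le.2 ht) h0).2.le
  have ha : ‖F c‖ < ‖F (c + b)‖ := by simpa using (hb 1 (by simp) one_ne_zero).1
  have hb' : ‖F c‖ < ‖F (c - b)‖ := by
    have := (hb (-1) (by simp) (by simp)).1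
    simpa [← sub_eq_add_neg] using this
  obtain ⟨sa, hsa, hsa2⟩ := exists_sqrt_sub_of_norm_le hLc hF hLF ha
  obtain ⟨sb, hsb, hsb2⟩ := exists_sqrt_sub_of_norm_le hLc hF hLF hb'
  have hnb : ∀ z ∈ L, z - (c - b) ≠ 0 := fun z hz h0 => by
    rw [sub_eq_zero.1 h0] at hz
    exact absurd (hLF _ hz) (not_le.2 hb')
  have hna : ∀ z ∈ L, z - (c + b) ≠ 0 := fun z hz h0 => by
    rw [sub_eq_zero.1 h0] at hz
    exact absurd (hLF _ hz) (not_le.2 ha)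
  have hsb0 : ∀ z ∈ L, sb z ≠ 0 := fun z hz h0 => hnb z hz (by rw [← hsb2 z hz, h0]; simp)
  set ρ : ℂ → ℂ := fun z => (z - (c + b)) / (z - (c - b)) with hρ
  have hρc : ContinuousOn ρ L := (by fun_prop : ContinuousOn (fun z : ℂ => z - (c + b)) L).div
    (by fun_prop) hnb
  have hρ0 : ∀ z ∈ L, ρ z ≠ 0 := fun z hz => div_ne_zero (hna z hz) (hnb z hz)
  set s : ℂ → ℂ := fun z => sa z / sb z with hs
  have hsc : ContinuousOn s L := hsa.div hsb hsb0
  have hs2 : ∀ z ∈ L, s z ^ 2 = ρ z := fun z hz => by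
    simp only [hs, hρ, div_pow, hsa2 z hz, hsb2 z hz]
  have hI : (Complex.I : ℂ) - 1 ≠ 0 := fun h => by simpa using congrArg Complex.im h
  have hI' : (Complex.I : ℂ) + 1 ≠ 0 := fun h => by simpa using congrArg Complex.im h
  have hρt : ∀ t : ℝ, ρ (c + t * b * Complex.I) = (t * Complex.I - 1) / (t * Complex.I + 1) := by
    intro t
    have h1 : c + t * b * Complex.I - (c + b) = b * (t * Complex.I - 1) := by ring
    have h2 : c + t * b * Complex.I - (c - b) = b * (t * Complex.I + 1) := by ring
    simp only [hρ, h1, h2]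
    exact mul_div_mul_left _ _ hb0
  have hρp : ρ (c + b * Complex.I) = Complex.I := by
    have := hρt 1
    simp only [Complex.ofReal_one, one_mul] at this
    rw [this, div_eq_iff hI']
    linear_combination -Complex.I_mul_I
  have hρq : ρ (c - b * Complex.I) = -Complex.I := by
    have := hρt (-1)
    simp only [Complex.ofReal_neg, Complex.ofReal_one, neg_mul, one_mul, ← sub_eq_add_neg] at this
    have h2 : -Complex.I + 1 ≠ 0 := fun h => hI (by linear_combination -h)
    rw [this, div_eq_iff h2]
    linear_combination -Complex.I_mul_I
  have hG : s (c + b * Complex.I) * principalSqrt (ρ (c - b * Complex.I))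
      = s (c - b * Complex.I) * principalSqrt (ρ (c + b * Complex.I)) := by
    refine mul_eq_mul_of_sq_eq hGp (hsc.mono subset_union_left)
      (continuousOn_principalSqrt_comp (hρc.mono subset_union_left) ?_)
      (fun z _ => principalSqrt_ne_zero _)
      (fun z hz => by rw [hs2 z (Or.inl hz), principalSqrt_sq (hρ0 z (Or.inl hz))]) hpG hqG
    rintro z ⟨τ, rfl⟩
    have hzV : ‖F (γ τ)‖ < ‖F c‖ := hγ τ
    have hzL : γ τ ∈ L := Or.inl ⟨τ, rfl⟩
    generalize γ τ = z at hzV hzL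
    by_contra hcon
    rw [Complex.mem_slitPlane_iff, not_or, not_lt, not_not] at hcon
    obtain ⟨r, hr⟩ : ∃ r : ℝ, ρ z = -(r : ℂ) := ⟨-(ρ z).re, by
      apply Complex.ext <;> simp [hcon.2]⟩
    have hr0 : 0 ≤ r := by
      have := hcon.1
      rw [hr] at this
      simpa using this
    have hz : z = c + ((1 - r) / (1 + r) : ℝ) * b := by
      have h1 : z - (c + b) = -r * (z - (c - b)) := (div_eq_iff (hnb z hzL)).1 hr
      have h2 : (1 + r : ℂ) ≠ 0 := by
        exact_mod_cast (by linarith : (0:ℝ) < 1 + r).ne'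
      push_cast
      field_simp
      linear_combination h1
    rcases eq_or_ne ((1 - r) / (1 + r)) 0 with h0 | h0
    · rw [hz, h0] at hzV
      simp at hzV
    · have h3 : |(1 - r) / (1 + r)| ≤ 1 := by
        rw [abs_le, le_div_iff₀ (by linarith), div_le_iff₀ (by linarith)]
        constructor <;> linarith
      have h4 := (hb _ h3 h0).1
      rw [← hz] at h4
      exact lt_asymm h4 hzV
  have hS : s (c + b * Complex.I) * (Complex.I * principalSqrt (-ρ (c - b * Complex.I)))
      = s (c - b * Complex.I) * (Complex.I * principalSqrt (-ρ (c + b * Complex.I))) := by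
    refine mul_eq_mul_of_sq_eq hEp (hsc.mono subset_union_right)
      (t := fun z => Complex.I * principalSqrt (-ρ z))
      (continuousOn_const.mul (continuousOn_principalSqrt_comp (hρc.mono subset_union_right).neg
      ?_)) (fun z _ => mul_ne_zero Complex.I_ne_zero (principalSqrt_ne_zero _))
      (fun z hz => by
        rw [hs2 z (Or.inr hz), mul_pow, principalSqrt_sq (neg_ne_zero.2 (hρ0 z (Or.inr hz)))]
        simp) hpE hqE
    rintro _ ⟨t, ht, rfl⟩
    show -ρ (c + t * b * Complex.I) ∈ Complex.slitPlane
    rw [hρt]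
    have h1 : (0:ℝ) < 1 + t ^ 2 := by positivity
    have h2 : (t * Complex.I + 1 : ℂ) ≠ 0 := fun h => by simpa using congrArg Complex.re h
    have h1' : (1 + t ^ 2 : ℂ) ≠ 0 := by exact_mod_cast h1.ne'
    have h3 : -((t * Complex.I - 1) / (t * Complex.I + 1) : ℂ)
        = (((1 - t ^ 2) / (1 + t ^ 2) : ℝ) : ℂ) + ((-2 * t / (1 + t ^ 2) : ℝ) : ℂ) * Complex.I := by
      push_cast
      rw [neg_div', div_eq_iff h2]
      field_simp
      ring_nf
      simp only [Complex.I_sq]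
      ring
    rw [h3, Complex.mem_slitPlane_iff]
    rcases eq_or_ne t 0 with rfl | h0
    · left; simp
    · right
      simp only [Complex.add_im, Complex.ofReal_im, Complex.mul_im, Complex.ofReal_re,
        Complex.I_im, Complex.I_re, mul_one, mul_zero, add_zero, zero_add]
      exact div_ne_zero (by simpa using h0) h1.ne'
  rw [hρp, hρq] at hG hS
  rw [neg_neg] at hS
  rw [principalSqrt_I] at hG hS
  have hk := principalSqrt_ne_zero (-Complex.I)
  have e1 : s (c + b * Complex.I) = s (c - b * Complex.I) * Complex.I :=
    mul_right_cancel₀ hk (by linear_combination hG)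
  have e2 : s (c + b * Complex.I) * Complex.I = s (c - b * Complex.I) :=
    mul_right_cancel₀ hk (mul_left_cancel₀ Complex.I_ne_zero (by linear_combination hS))
  have e3 : s (c + b * Complex.I) = 0 := by
    have : s (c + b * Complex.I) * 2 = 0 := by
      linear_combination e1 - Complex.I * e2 + s (c + b * Complex.I) * Complex.I_mul_I
    simpa using this
  have := hs2 _ (Or.inl hpG)
  rw [e3, hρp] at this
  simpa using this.symm

/-- Component through `z` of the `n`-th preimage of `U`. -/
def piece (f : ℂ → ℂ) (U : Set ℂ) (n : ℕ) (z : ℂ) : Set ℂ :=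
  connectedComponentIn (preimage (f^[n]) U) z

/-- A domain `U` whose preimage under `f` is relatively compact in `U`. -/
structure IsPuzzle (f : ℂ → ℂ) (U : Set ℂ) : Prop where
  differentiable : Differentiable ℂ f
  isOpenMap : IsOpenMap f
  isClosedMap : IsClosedMap f
  isOpen : IsOpen U
  isPreconnected : IsPreconnected U
  isBounded : Bornology.IsBounded U
  closure_subset : closure (f ⁻¹' U) ⊆ U

namespace IsPuzzle

variable {f : ℂ → ℂ} {U : Set ℂ}

theorem continuous_iterate (h : IsPuzzle f U)
    (n : ℕ) : Continuous f^[n] := h.differentiable.continuous.iterate n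

theorem isOpen_preimage (h : IsPuzzle f U)
    (n : ℕ) : IsOpen (f^[n] ⁻¹' U) := h.isOpen.preimage (h.continuous_iterate n)

theorem isOpen_piece (h : IsPuzzle f U) (n : ℕ) (z : ℂ) : IsOpen (piece f U n z) :=
  (h.isOpen_preimage n).connectedComponentIn

theorem preimage_subset (h : IsPuzzle f U) : f ⁻¹' U ⊆ U := subset_closure.trans h.closure_subset

theorem closure_preimage_succ_subset (h : IsPuzzle f U) (n : ℕ) :
    closure (f^[n + 1] ⁻¹' U) ⊆ f^[n] ⁻¹' U := by
  have h1 : f^[n + 1] ⁻¹' U = f^[n] ⁻¹' (f ⁻¹' U) := by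
    rw [Function.iterate_succ', preimage_comp]
  rw [h1]
  exact ((h.continuous_iterate n).closure_preimage_subset _).trans
    (preimage_mono h.closure_subset)

theorem preimage_antitone (h : IsPuzzle f U) : Antitone fun n => f^[n] ⁻¹' U :=
  antitone_nat_of_succ_le fun n => subset_closure.trans (h.closure_preimage_succ_subset n)

theorem piece_antitone (h : IsPuzzle f U)
    (z : ℂ) : Antitone fun n => piece f U n z := fun _ _ hmn =>
  connectedComponentIn_mono _ (h.preimage_antitone hmn)

theorem image_piece_succ (h : IsPuzzle f U) {n : ℕ} {z : ℂ} (hz : f^[n + 1] z ∈ U) :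
    f '' piece f U (n + 1) z = piece f U n (f z) :=
  image_connectedComponentIn_preimage h.differentiable.continuous h.isOpenMap h.isClosedMap
    (h.isOpen_preimage n) (x := z) hz

theorem image_iterate_piece (h : IsPuzzle f U) (k : ℕ) {n : ℕ} {z : ℂ} (hz : f^[n + k] z ∈ U) :
    f^[k] '' piece f U (n + k) z = piece f U n (f^[k] z) := by
  induction k generalizing z with
  | zero => simp
  | succ k ih =>
    have h1 := h.image_piece_succ (n := n + k) (z := z) hz
    rw [Function.iterate_succ, image_comp, ← add_assoc, h1, ih hz]
    rfl

end IsPuzzle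

theorem piece_subset {f : ℂ → ℂ} {U : Set ℂ} {n : ℕ} {z : ℂ} :
    piece f U n z ⊆ f^[n] ⁻¹' U := connectedComponentIn_subset _ _

theorem mem_piece {f : ℂ → ℂ} {U : Set ℂ} {n : ℕ} {z : ℂ} (hz : f^[n] z ∈ U) :
    z ∈ piece f U n z := mem_connectedComponentIn hz

theorem piece_eq {f : ℂ → ℂ} {U : Set ℂ} {n : ℕ} {z w : ℂ} (hw : w ∈ piece f U n z) :
    piece f U n z = piece f U n w := connectedComponentIn_eq hw

theorem mem_piece_comm {f : ℂ → ℂ} {U : Set ℂ} {n : ℕ} {z w : ℂ} (hw : w ∈ piece f U n z) :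
    z ∈ piece f U n w := by
  rw [← piece_eq hw]
  have : w ∈ f^[n] ⁻¹' U := piece_subset hw
  by_contra hz
  rw [piece, connectedComponentIn_eq_empty] at hw
  · exact hw
  · exact fun hz' => hz (mem_piece hz')

namespace IsPuzzle

variable {f : ℂ → ℂ} {U : Set ℂ}

theorem piece_zero (h : IsPuzzle f U) {z : ℂ} (hz : z ∈ U) : piece f U 0 z = U :=
  h.isPreconnected.connectedComponentIn hz

theorem image_piece_one (h : IsPuzzle f U) {z : ℂ} (hz : f z ∈ U) : f '' piece f U 1 z = U := by
  have h1 := h.image_piece_succ (n := 0) (z := z) hz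
  rwa [h.piece_zero hz] at h1

theorem image_iterate_piece_self (h : IsPuzzle f U) {n : ℕ} {z : ℂ} (hz : f^[n] z ∈ U) :
    f^[n] '' piece f U n z = U := by
  have := h.image_iterate_piece n (n := 0) (z := z) (by simpa using hz)
  rw [h.piece_zero hz, zero_add] at this
  exact this

end IsPuzzle

/-- A puzzle for a cubic-like map whose critical piece of depth one is a two-to-one
preimage of `U`, branched only over `f c`, the other preimage of `f c` being `e`. -/
structure IsCubicPuzzle (f : ℂ → ℂ) (U : Set ℂ) (c e : ℂ) : Prop extends IsPuzzle f U where
  mem_U : ∀ n, f^[n] c ∈ U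
  e_mem : e ∈ U
  apply_e : f e = f c
  e_notMem : e ∉ piece f U 1 c
  eq_of_apply_eq : ∀ x ∈ piece f U 1 c, f x = f c → x = c
  two_to_one : ∀ x ∈ piece f U 1 c, ∀ y ∈ piece f U 1 c, ∀ z ∈ piece f U 1 c,
    f x = f y → f x = f z → x = y ∨ x = z ∨ y = z
  injOn : ∀ n z, c ∉ piece f U (n + 1) z → InjOn f (piece f U (n + 1) z)

section Cubic

variable {a c₀ c₁ v₀ : ℂ} {f : ℂ → ℂ}

theorem cubic_quadratic_relation (ha : a ≠ 0)
    (hf : ∀ z, f z = a * (z - c₀) ^ 2 * (z - (3 * c₁ - c₀) / 2) + v₀)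
    {x y : ℂ} (hne : x ≠ y) (hxy : f x = f y) :
    x * y + (x + y) * (3 / 2 * (c₀ + c₁) - x - y) = 3 * c₀ * c₁ := by
  rw [hf, hf] at hxy
  have h1 : a * (x - y) ≠ 0 := mul_ne_zero ha (sub_ne_zero.2 hne)
  refine mul_left_cancel₀ h1 ?_
  linear_combination -hxy

theorem cubic_sum_roots (ha : a ≠ 0)
    (hf : ∀ z, f z = a * (z - c₀) ^ 2 * (z - (3 * c₁ - c₀) / 2) + v₀)
    {x y z : ℂ} (hxy : x ≠ y) (hxz : x ≠ z) (hyz : y ≠ z) (h1 : f x = f y) (h2 : f x = f z) :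
    x + y + z = 3 / 2 * (c₀ + c₁) := by
  have e1 := cubic_quadratic_relation ha hf hxy h1
  have e2 := cubic_quadratic_relation ha hf hxz h2
  refine mul_left_cancel₀ (sub_ne_zero.2 hyz) ?_
  linear_combination e2 - e1

theorem cubic_discriminant (ha : a ≠ 0)
    (hf : ∀ z, f z = a * (z - c₀) ^ 2 * (z - (3 * c₁ - c₀) / 2) + v₀)
    {x y z : ℂ} (hxy : x ≠ y) (h : f x = f y) (hz : z = 3 / 2 * (c₀ + c₁) - x - y) :
    (a * (x - z) * (y - x) * (y - z)) ^ 2 = -27 * ((f x - f c₀) * (f x - f c₁)) := by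
  have q := cubic_quadratic_relation ha hf hxy h
  rw [← hz] at q
  have A1 : (x - y) * (x - z) = 3 * (x - c₀) * (x - c₁) := by
    rw [hz] at q ⊢; linear_combination q
  have A2 : (y - x) * (y - z) = 3 * (y - c₀) * (y - c₁) := by
    rw [hz] at q ⊢; linear_combination q
  have A3 : (z - x) * (z - y) = 3 * (z - c₀) * (z - c₁) := by
    rw [hz] at q ⊢; linear_combination q
  have G0 : f x - f c₀ = a * ((x - c₀) * (y - c₀) * (z - c₀)) := by
    rw [hf, hf]; rw [hz] at q ⊢; linear_combination (-a * (x - c₀)) * q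
  have G1 : f x - f c₁ = a * ((x - c₁) * (y - c₁) * (z - c₁)) := by
    rw [hf, hf]; rw [hz] at q ⊢; linear_combination (-a * (x - c₁)) * q
  rw [G0, G1]
  calc (a * (x - z) * (y - x) * (y - z)) ^ 2
      = -a ^ 2 * (((x - y) * (x - z)) * ((y - x) * (y - z)) * ((z - x) * (z - y))) := by ring
    _ = _ := by rw [A1, A2, A3]; ring

theorem injOn_piece_of_critical_notMem (ha : a ≠ 0)
    (hf : ∀ z, f z = a * (z - c₀) ^ 2 * (z - (3 * c₁ - c₀) / 2) + v₀)
    {U : Set ℂ} (h : IsPuzzle f U) {N : ℕ} {R : ℝ} (hU : U = {z | ‖f^[N] z‖ < R})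
    (hv₁ : f c₁ ∉ U) {e : ℂ} (hB : InjOn f (piece f U 1 e))
    (hBs : f '' piece f U 1 e = U) (hdis : Disjoint (piece f U 1 c₀) (piece f U 1 e))
    (hcov : f ⁻¹' U ⊆ piece f U 1 c₀ ∪ piece f U 1 e)
    (huniq : ∀ x ∈ piece f U 1 c₀, f x = f c₀ → x = c₀)
    {n : ℕ} {z : ℂ} (hz : c₀ ∉ piece f U (n + 1) z) : InjOn f (piece f U (n + 1) z) := by
  by_cases hzU : f^[n + 1] z ∈ U
  swap
  · have : piece f U (n + 1) z = ∅ := connectedComponentIn_eq_empty hzU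
    rw [this]; exact injOn_empty _
  have hsub1 : piece f U (n + 1) z ⊆ piece f U 1 z := h.piece_antitone z (by omega)
  have hz1 : z ∈ piece f U 1 z := hsub1 (mem_piece hzU)
  rcases hcov (show z ∈ f ⁻¹' U from piece_subset (n := 1) hz1) with hzA | hzB
  swap
  · rw [← piece_eq hzB] at hsub1
    exact hB.mono hsub1
  rw [← piece_eq hzA] at hsub1
  intro x hx y hy hxy
  by_contra hne
  have him := h.image_piece_succ hzU
  set P' := piece f U (n + 1) z with hP'
  have hP'U : ∀ u ∈ P', f u ∈ U := fun u hu =>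
    piece_subset (f := f) (n := 1) (hsub1 hu)
  have hv0 : f c₀ ∉ piece f U n (f z) := fun hv => by
    rw [← him] at hv
    obtain ⟨u, hu, hu'⟩ := hv
    exact hz (huniq u (hsub1 hu) hu' ▸ hu)
  have hv1 : f c₁ ∉ piece f U n (f z) := fun hv => by
    rw [← him] at hv
    obtain ⟨u, hu, hu'⟩ := hv
    exact hv₁ (hu' ▸ hP'U u hu)
  have hpc : IsPathConnected P' := ((h.isOpen_piece _ _).isConnected_iff_isPathConnected).1
    ⟨⟨x, hx⟩, isPreconnected_connectedComponentIn⟩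
  obtain ⟨γ, hγ⟩ := hpc.joinedIn _ hx _ hy
  have hΓ : range γ ⊆ P' := range_subset_iff.2 hγ
  have hΓp : IsPreconnected (range γ) := isPreconnected_range γ.continuous
  have hfc := h.differentiable.continuous
  have hLc : IsCompact (f '' range γ) := (isCompact_range γ.continuous).image hfc
  have hLP : f '' range γ ⊆ piece f U n (f z) := (image_mono hΓ).trans him.subset
  have hFd : Differentiable ℂ fun w => f^[N] (f^[n] w) :=
    (h.differentiable.iterate N).comp (h.differentiable.iterate n)
  have hpe : ∀ w, piece f U n w = connectedComponentIn {u | ‖f^[N] (f^[n] u)‖ < R} w := by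
    intro w; rw [piece, hU]; rfl
  rw [hpe] at hLP hv0 hv1
  obtain ⟨s₀, hs₀, hs₀2⟩ := exists_sqrt_sub_of_subset_component hLc hFd hLP hv0
  obtain ⟨s₁, hs₁, hs₁2⟩ := exists_sqrt_sub_of_subset_component hLc hFd hLP hv1
  have hgc : ContinuousOn (invFunOn f (piece f U 1 e)) U := by
    have := (h.isOpenMap.domRestrict (h.isOpen_piece 1 e)).continuousOn_image_of_leftInvOn
      hB.leftInvOn_invFunOn
    rwa [hBs] at this
  set g := invFunOn f (piece f U 1 e) with hg
  have hgB : ∀ w ∈ U, g w ∈ piece f U 1 e ∧ f (g w) = w := fun w hw => by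
    rw [← hBs] at hw
    exact ⟨invFunOn_mem hw, invFunOn_eq hw⟩
  have hτ : ContinuousOn (fun u => g (f u)) P' := hgc.comp hfc.continuousOn hP'U
  have hτne : ∀ u ∈ P', u ≠ g (f u) := fun u hu heq =>
    Set.disjoint_left.1 hdis (hsub1 hu) (heq ▸ (hgB _ (hP'U u hu)).1)
  obtain ⟨κ, hκ⟩ := IsAlgClosed.exists_pow_nat_eq (-27 : ℂ) (n := 2) (by norm_num)
  have hκ0 : κ ≠ 0 := by rintro rfl; norm_num at hκ
  set H : ℂ → ℂ := fun u => a * (u - (3 / 2 * (c₀ + c₁) - u - g (f u))) * (g (f u) - u) *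
    (g (f u) - (3 / 2 * (c₀ + c₁) - u - g (f u))) with hH
  have hHc : ContinuousOn H P' := by
    have hid : ContinuousOn (fun u : ℂ => 3 / 2 * (c₀ + c₁) - u) P' := by fun_prop
    exact ((continuousOn_const.mul (continuousOn_id.sub (hid.sub hτ))).mul
      (hτ.sub continuousOn_id)).mul (hτ.sub (hid.sub hτ))
  have hmaps : MapsTo f (range γ) (f '' range γ) := mapsTo_image _ _
  set t : ℂ → ℂ := fun u => κ * (s₀ (f u) * s₁ (f u)) with ht
  have htc : ContinuousOn t (range γ) := continuousOn_const.mul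
    ((hs₀.comp hfc.continuousOn hmaps).mul (hs₁.comp hfc.continuousOn hmaps))
  have ht2 : ∀ u ∈ range γ, t u ^ 2 = -27 * ((f u - f c₀) * (f u - f c₁)) := fun u hu => by
    simp only [ht, mul_pow, hκ, hs₀2 _ (hmaps hu), hs₁2 _ (hmaps hu)]
  have ht0 : ∀ u ∈ range γ, t u ≠ 0 := fun u hu h0 => by
    have h2 := ht2 u hu
    rw [h0] at h2
    have hfu : f u ∈ connectedComponentIn {u | ‖f^[N] (f^[n] u)‖ < R} (f z) := hLP (hmaps hu)
    have h3 : (f u - f c₀) * (f u - f c₁) = 0 := by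
      have : (-27 : ℂ) * ((f u - f c₀) * (f u - f c₁)) = 0 := by rw [← h2]; simp
      simpa using this
    rcases mul_eq_zero.1 h3 with h4 | h4
    · exact hv0 (sub_eq_zero.1 h4 ▸ hfu)
    · exact hv1 (sub_eq_zero.1 h4 ▸ hfu)
  have key := mul_eq_mul_of_sq_eq hΓp (hHc.mono hΓ) htc ht0 (fun u hu => by
    rw [ht2 u hu]
    exact cubic_discriminant ha hf (hτne u (hΓ hu)) (hgB _ (hP'U u (hΓ hu))).2.symm rfl)
    (p := x) (q := y) ⟨0, γ.source⟩ ⟨1, γ.target⟩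
  have hxΓ : x ∈ range γ := ⟨0, γ.source⟩
  have hteq : t y = t x := by simp only [ht, hxy]
  rw [hteq] at key
  have key2 : H x = H y := mul_right_cancel₀ (ht0 x hxΓ) key
  have hsum := cubic_sum_roots ha hf hne (hτne x hx)
    (by rw [hxy]; exact hτne y hy) hxy (hgB _ (hP'U x hx)).2.symm
  have hHx : H x = a * (x - y) * (g (f x) - x) * (g (f x) - y) := by
    have : 3 / 2 * (c₀ + c₁) - x - g (f x) = y := by rw [← hsum]; ring
    simp only [hH, this]
  have hHy : H y = a * (y - x) * (g (f x) - y) * (g (f x) - x) := by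
    have : 3 / 2 * (c₀ + c₁) - y - g (f x) = x := by rw [← hsum]; ring
    simp only [hH, ← hxy, this]
  rw [hHx, hHy] at key2
  have e1 : a * (x - y) * (g (f x) - x) * (g (f x) - y) = 0 := by
    linear_combination (1 / 2) * key2
  rw [mul_eq_zero, mul_eq_zero, mul_eq_zero, sub_eq_zero, sub_eq_zero, sub_eq_zero] at e1
  rcases e1 with ((h1 | h1) | h1) | h1
  · exact ha h1
  · exact hne h1
  · exact hτne x hx h1.symm
  · exact hτne y hy (by rw [← hxy, h1])

theorem cubic_deriv (hf : ∀ z, f z = a * (z - c₀) ^ 2 * (z - (3 * c₁ - c₀) / 2) + v₀) (z : ℂ) :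
    deriv f z = 3 * a * (z - c₀) * (z - c₁) := by
  have h1 : HasDerivAt (fun z : ℂ => z - c₀) 1 z := (hasDerivAt_id z).sub_const _
  have h2 : HasDerivAt (fun z : ℂ => z - (3 * c₁ - c₀) / 2) 1 z := (hasDerivAt_id z).sub_const _
  have h3 := (((h1.pow 2).const_mul a).mul h2).add_const v₀
  have h4 : f = fun z => a * (z - c₀) ^ 2 * (z - (3 * c₁ - c₀) / 2) + v₀ := funext hf
  rw [h4]
  refine Eq.trans (HasDerivAt.deriv h3) ?_
  simp
  ring

theorem isCubicPuzzle_of_cubic (ha : a ≠ 0)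
    (hf : ∀ z, f z = a * (z - c₀) ^ 2 * (z - (3 * c₁ - c₀) / 2) + v₀)
    {U : Set ℂ} (h : IsPuzzle f U) {N : ℕ} {R : ℝ} (hR : 0 < R)
    (hU : U = {z | ‖f^[N] z‖ < R}) (hc₁ : ‖f^[N + 1] c₁‖ = R)
    (hd : deriv f^[N] (f c₁) ≠ 0) (hc₀ : ∀ n, f^[n] c₀ ∈ U) :
    IsCubicPuzzle f U c₀ ((3 * c₁ - c₀) / 2) := by
  set e := (3 * c₁ - c₀) / 2 with he
  have hv₁ : f c₁ ∉ U := by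
    rw [hU]
    simp only [mem_ofPred_eq, not_lt]
    exact hc₁.ge
  have hne : c₁ ≠ c₀ := by
    rintro rfl
    exact hv₁ (hc₀ 1)
  have hv₀ : f c₀ = v₀ := by rw [hf]; simp
  have hpre : ∀ z, f z = f c₀ → z = c₀ ∨ z = e := fun z hz => by
    rw [hv₀, hf, add_eq_right, mul_eq_zero, mul_eq_zero, sub_eq_zero] at hz
    rcases hz with (h1 | h1) | h1
    · exact absurd h1 ha
    · left; exact sub_eq_zero.1 (pow_eq_zero_iff two_ne_zero |>.1 h1)
    · exact Or.inr h1
  have hfe : f e = f c₀ := by rw [hv₀, hf]; simp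
  have hc₀1 : f c₀ ∈ U := hc₀ 1
  have hfeU : f e ∈ U := hfe ▸ hc₀1
  have hcov : f ⁻¹' U ⊆ piece f U 1 c₀ ∪ piece f U 1 e := fun z hz => by
    have h1 := h.image_piece_one (z := z) hz
    rw [← h1] at hc₀1
    obtain ⟨w, hw, hw'⟩ := hc₀1
    rcases hpre w hw' with rfl | rfl
    · exact Or.inl (mem_piece_comm hw)
    · exact Or.inr (mem_piece_comm hw)
  have heA : e ∉ piece f U 1 c₀ := fun heA => by
    have hA : piece f U 1 c₀ = f ⁻¹' U := by
      refine Subset.antisymm (piece_subset (n := 1)) fun z hz => ?_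
      rcases hcov hz with h1 | h1
      · exact h1
      · rwa [← piece_eq heA] at h1
    have hVp : IsPreconnected (f ⁻¹' U) := hA ▸ isPreconnected_connectedComponentIn
    have hFd : Differentiable ℂ f^[N + 1] := h.differentiable.iterate _
    refine not_isPreconnected_of_critical hFd (c := c₁)
      (h := fun z => a * (z - (3 * c₀ - c₁) / 2) * dslope f^[N] (f c₁) (f z)) ?_ ?_ ?_ ?_ ?_
    · refine ((by fun_prop : Continuous fun z => a * (z - (3 * c₀ - c₁) / 2)).continuousAt).mul ?_
      exact ContinuousAt.comp (f := f)
        (continuousAt_dslope_same.2 (h.differentiable.iterate N).differentiableAt)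
        h.differentiable.continuous.continuousAt
    · simp only [dslope_same]
      refine mul_ne_zero (mul_ne_zero ha ?_) hd
      intro h0
      exact hne (by linear_combination (2 / 3) * h0)
    · rw [← norm_pos_iff, hc₁]; exact hR
    · intro z
      have h1 := sub_smul_dslope f^[N] (f c₁) (f z)
      rw [smul_eq_mul] at h1
      have h2 : f z - f c₁ = (z - c₁) ^ 2 * (a * (z - (3 * c₀ - c₁) / 2)) := by
        rw [hf, hf]; ring
      rw [h2] at h1
      rw [Function.iterate_succ_apply, Function.iterate_succ_apply]
      linear_combination -h1
    · rw [hc₁]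
      rw [hU] at hVp
      exact hVp
  have hAB : Disjoint (piece f U 1 c₀) (piece f U 1 e) := by
    rw [Set.disjoint_left]
    intro z h1 h2
    rw [piece_eq h1] at heA
    exact heA (mem_piece_comm h2)
  have hBs : f '' piece f U 1 e = U := h.image_piece_one hfeU
  have hc₀A : c₀ ∈ piece f U 1 c₀ := mem_piece hc₀1
  have hBU : piece f U 1 e ⊆ f ⁻¹' U := piece_subset
  have hB : InjOn f (piece f U 1 e) := by
    refine injOn_of_unramified h.differentiable h.isOpenMap h.isPreconnected (h.isOpen_piece 1 e)
      (h.isBounded.subset (hBU.trans h.preimage_subset))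
      (closure_connectedComponentIn_inter_subset (h.isOpen_preimage 1) e) ?_ hBU hc₀1 ?_
    · intro z hz
      rw [cubic_deriv hf]
      refine mul_ne_zero (mul_ne_zero (mul_ne_zero three_ne_zero ha) ?_) ?_
      · intro h0
        rw [sub_eq_zero.1 h0] at hz
        exact Set.disjoint_left.1 hAB hc₀A hz
      · intro h0
        rw [sub_eq_zero.1 h0] at hz
        exact hv₁ (hBU hz)
    · have : ∀ z ∈ piece f U 1 e ∩ f ⁻¹' {f c₀}, z = e := fun z hz => by
        rcases hpre z hz.2 with rfl | h1
        · exact absurd hz.1 (Set.disjoint_left.1 hAB hc₀A)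
        · exact h1
      exact fun x hx y hy => (this x hx).trans (this y hy).symm
  have huniq : ∀ x ∈ piece f U 1 c₀, f x = f c₀ → x = c₀ := fun x hx hx' => by
    rcases hpre x hx' with h1 | rfl
    · exact h1
    · exact absurd hx heA
  refine ⟨h, hc₀, h.preimage_subset hfeU, hfe, heA, huniq, ?_, ?_⟩
  · intro x hx y hy z hz hxy hxz
    by_contra! hcon
    obtain ⟨h1, h2, h3⟩ := hcon
    have hxU : f x ∈ U := piece_subset (f := f) (n := 1) hx
    rw [← hBs] at hxU
    obtain ⟨b, hb, hb'⟩ := hxU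
    have hnb : ∀ u ∈ piece f U 1 c₀, u ≠ b := fun u hu hub =>
      Set.disjoint_left.1 hAB hu (hub ▸ hb)
    have e1 := cubic_sum_roots ha hf h1 (hnb x hx) (hnb y hy) hxy hb'.symm
    have e2 := cubic_sum_roots ha hf h2 (hnb x hx) (hnb z hz) hxz hb'.symm
    exact h3 (by linear_combination e1 - e2)
  · intro n z hz
    exact injOn_piece_of_critical_notMem ha hf h hU hv₁ hB hBs hAB hcov huniq hz

end Cubic

open scoped Classical in
/-- Number of critical positions on the diagonal starting at level `m`. -/
noncomputable def diagonalDepth (crit : ℕ → ℕ → Prop) (m : ℕ) : ℕ :=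
  ∑ j ∈ Finset.range m, if crit (m - j) j then 1 else 0

/-- Critical positions of the orbit of a critical point: `crit n j` says that the `j`-th
iterate lies in the critical piece of depth `n`. -/
structure IsCriticalTableau (crit : ℕ → ℕ → Prop) : Prop where
  zero_time : ∀ n, crit n 0
  mono : ∀ n j, crit (n + 1) j → crit n j
  transfer : ∀ n i j m, crit (n + i) j → m ≤ n → (crit m (j + i) ↔ crit m i)
  ascend : ∀ n k s p, 0 < k → crit (n + k) s → (∀ i, 0 < i → i < k → ¬ crit (n + k - i) i) →
    crit (n + p) k → crit (n + p) (s + k) → crit (n + p + k) s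

/-- Critical positions of the orbit of an arbitrary point, relative to those of the critical
point. -/
structure IsTableauOver (crit crit' : ℕ → ℕ → Prop) : Prop where
  mono : ∀ n j, crit' (n + 1) j → crit' n j
  transfer : ∀ n i j m, crit' (n + i) j → m ≤ n → (crit' m (j + i) ↔ crit m i)

theorem IsCriticalTableau.isTableauOver {crit : ℕ → ℕ → Prop} (h : IsCriticalTableau crit) :
    IsTableauOver crit crit := ⟨h.mono, h.transfer⟩

namespace IsTableauOver

variable {crit crit' : ℕ → ℕ → Prop}

theorem anti (h : IsTableauOver crit crit')
    {m n : ℕ} (hmn : m ≤ n) {j : ℕ} (hc : crit' n j) : crit' m j := by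
  induction n, hmn using Nat.le_induction with
  | base => exact hc
  | succ n _ ih => exact ih (h.mono n j hc)

open scoped Classical in
theorem diagonalDepth_add (h : IsTableauOver crit crit') {n l : ℕ} (hc : crit' n l) :
    diagonalDepth crit' (l + n) =
      (∑ j ∈ Finset.range l, if crit' (l + n - j) j then 1 else 0) + diagonalDepth crit n := by
  rw [diagonalDepth, diagonalDepth, Finset.sum_range_add]
  congr 1
  refine Finset.sum_congr rfl fun i hi => ?_
  have hi' := Finset.mem_range.1 hi
  have e1 : l + n - (l + i) = n - i := by omega
  have := h.transfer (n - i) i l (n - i) (by rwa [Nat.sub_add_cancel hi'.le]) le_rfl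
  rw [e1]
  simp only [this]

end IsTableauOver


theorem ENNReal.tsum_half_pow_eq_top_of_le {d : ℕ → ℕ} {M : ℕ} (hd : ∀ n, d n ≤ M) :
    ∑' n, (2⁻¹ : ℝ≥0∞) ^ d n = ∞ := by
  have h1 : ∑' _ : ℕ, (2⁻¹ : ℝ≥0∞) ^ M = ∞ :=
    ENNReal.tsum_const_eq_top_of_ne_zero (pow_ne_zero _ (by simp))
  refine top_le_iff.1 (h1 ▸ ENNReal.tsum_le_tsum fun n => ?_)
  exact pow_le_pow_of_le_one zero_le (by simp) (hd n)

open scoped Classical in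
theorem diagonalDepth_le {crit : ℕ → ℕ → Prop} {m M : ℕ}
    (h : ∀ j, 0 < j → j < m → crit (m - j) j → m - j < M) : diagonalDepth crit m ≤ M + 1 := by
  rw [diagonalDepth, Finset.sum_boole, Nat.cast_id]
  have : (Finset.range m).filter (fun j => crit (m - j) j) ⊆
      insert 0 ((Finset.range M).image fun i => m - i) := by
    intro j hj
    rw [Finset.mem_filter, Finset.mem_range] at hj
    rcases Nat.eq_zero_or_pos j with rfl | hj0
    · simp
    · refine Finset.mem_insert_of_mem (Finset.mem_image.2 ⟨m - j, ?_, by omega⟩)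
      exact Finset.mem_range.2 (h j hj0 hj.1 hj.2)
  refine (Finset.card_le_card this).trans ((Finset.card_insert_le _ _).trans ?_)
  exact Nat.succ_le_succ (Finset.card_image_le.trans (by simp))

namespace IsCriticalTableau

variable {crit : ℕ → ℕ → Prop}

/-- The first return time to the critical piece of depth `n` is unique among the times of
children of `n` only if the critical end is periodic. -/
theorem exists_second_child (h : IsCriticalTableau crit) (hrec : ∀ M, ∃ j, 0 < j ∧ crit M j)
    (hap : ∀ k, 0 < k → ∃ n, ¬ crit n k) (n : ℕ) :
    ∃ k l, 0 < k ∧ 0 < l ∧ k ≠ l ∧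
      (crit n k ∧ ∀ i, 0 < i → i < k → ¬ crit (n + k - i) i) ∧
      (crit n l ∧ ∀ i, 0 < i → i < l → ¬ crit (n + l - i) i) := by
  have hT := h.isTableauOver
  obtain ⟨k, ⟨hk0, hkn⟩, hkmin⟩ : ∃ k, (0 < k ∧ crit n k) ∧ ∀ i, 0 < i → i < k → ¬ crit n i := by
    classical
    refine ⟨Nat.find (hrec n), Nat.find_spec (hrec n), fun i hi hik hc => ?_⟩
    exact Nat.find_min (hrec n) hik ⟨hi, hc⟩
  have hkchild : ∀ i, 0 < i → i < k → ¬ crit (n + k - i) i := fun i hi hik hc =>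
    hkmin i hi hik (hT.anti (by omega) hc)
  by_contra! hcon
  have hone : ∀ l, 0 < l → crit n l → (∀ i, 0 < i → i < l → ¬ crit (n + l - i) i) → l = k := by
    intro l hl hc hch
    by_contra hne
    obtain ⟨i, hi, hil, hci⟩ := hcon k l hk0 hl (Ne.symm hne) ⟨hkn, hkchild⟩ hc
    exact hch i hi hil hci
  have claim : ∀ l, 0 < l → crit n l → k ≤ l ∧ crit (n + k) (l - k) := by
    classical
    intro l hl hc
    obtain ⟨j, ⟨hjl, hj⟩, hjmax⟩ : ∃ j, (j < l ∧ crit (n + l - j) j) ∧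
        ∀ i, j < i → i < l → ¬ crit (n + l - i) i := by
      set P : ℕ → Prop := fun j => j < l ∧ crit (n + l - j) j with hP
      have hP0 : P 0 := ⟨hl, h.zero_time _⟩
      refine ⟨Nat.findGreatest P l, Nat.findGreatest_spec (Nat.zero_le l) hP0, ?_⟩
      intro i hi hil hci
      exact Nat.findGreatest_is_greatest hi hil.le ⟨hil, hci⟩
    have hl' : l - j = k := by
      refine hone (l - j) (by omega) ?_ ?_
      · have := (h.transfer n (l - j) j n (by
          rwa [← Nat.add_sub_assoc hjl.le]) le_rfl)
        rw [Nat.add_sub_cancel' hjl.le] at this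
        exact this.1 hc
      · intro i hi hil hci
        have := (h.transfer (n + (l - j) - i) i j _ (by
          rw [Nat.sub_add_cancel (by omega), ← Nat.add_sub_assoc hjl.le]; exact hj) le_rfl).2 hci
        refine hjmax (j + i) (by omega) (by omega) ?_
        convert this using 1
        omega
    have hjk : j = l - k := by omega
    refine ⟨by omega, ?_⟩
    rw [← hjk]
    convert hj using 1
    omega
  have hinf : ∀ s, ∃ s', s < s' ∧ crit n s' := by
    intro s
    have : ∃ M, n ≤ M ∧ ∀ i, 0 < i → i ≤ s → ¬ crit M i := by
      induction s with
      | zero => exact ⟨n, le_rfl, fun i hi hi' => by omega⟩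
      | succ s ih =>
        obtain ⟨M, hM, hMi⟩ := ih
        obtain ⟨M', hM'⟩ := hap (s + 1) (by omega)
        refine ⟨max M M', le_max_of_le_left hM, fun i hi his hc => ?_⟩
        rcases Nat.lt_or_eq_of_le his with h1 | rfl
        · exact hMi i hi (by omega) (hT.anti (le_max_left _ _) hc)
        · exact hM' (hT.anti (le_max_right _ _) hc)
    obtain ⟨M, hM, hMi⟩ := this
    obtain ⟨j, hj, hcj⟩ := hrec M
    refine ⟨j, ?_, hT.anti hM hcj⟩
    by_contra! hjs
    exact hMi j hj hjs hcj
  have hstep : ∀ s, crit n s → crit (n + k) s ∧ crit n (s + k) := by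
    classical
    intro s hs
    have hex := hinf s
    obtain ⟨hlt, hc⟩ := Nat.find_spec hex
    have hmin := fun i (hi : i < Nat.find hex) => Nat.find_min hex hi
    generalize Nat.find hex = s' at hlt hc hmin
    obtain ⟨hks, hck⟩ := claim s' (by omega) hc
    have hle : s' - k ≤ s := by
      by_contra! hgt
      exact hmin (s' - k) (by omega) ⟨hgt, hT.anti (by omega) hck⟩
    have heq : s' - k = s := by
      by_contra hne
      have h1 := h.transfer n (s - (s' - k)) (s' - k) n (hT.anti (by omega) hck) le_rfl
      rw [Nat.add_sub_cancel' hle] at h1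
      exact hkmin _ (by omega) (by omega) (h1.1 hs)
    rw [heq] at hck
    refine ⟨hck, ?_⟩
    have : s + k = s' := by omega
    rwa [this]
  have hall : ∀ p s, crit n s → crit (n + p * k) s := by
    intro p
    induction p with
    | zero => intro s hs; simpa using hs
    | succ p ih =>
      intro s hs
      have := h.ascend n k s (p * k) hk0 (hstep s hs).1 hkchild (ih k hkn) (ih _ (hstep s hs).2)
      rwa [add_one_mul, ← add_assoc]
  obtain ⟨m, hm⟩ := hap k hk0
  refine hm (hT.anti ?_ (hall m k hkn))
  nlinarith

theorem diagonalDepth_child (h : IsCriticalTableau crit) {n l : ℕ} (hl : 0 < l) (hc : crit n l)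
    (hch : ∀ i, 0 < i → i < l → ¬ crit (n + l - i) i) :
    diagonalDepth crit (n + l) = diagonalDepth crit n + 1 := by
  classical
  rw [add_comm n l, h.isTableauOver.diagonalDepth_add hc, add_comm]
  congr 1
  rw [Finset.sum_eq_single_of_mem 0 (Finset.mem_range.2 hl)]
  · simp [h.zero_time]
  · intro i hi hi0
    rw [if_neg]
    rw [add_comm l n]
    exact hch i (Nat.pos_of_ne_zero hi0) (Finset.mem_range.1 hi)

theorem tsum_eq_top (h : IsCriticalTableau crit) (hap : ∀ k, 0 < k → ∃ n, ¬ crit n k) :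
    ∑' n, (2⁻¹ : ℝ≥0∞) ^ diagonalDepth crit n = ∞ := by
  by_cases hrec : ∀ M, ∃ j, 0 < j ∧ crit M j
  swap
  · push Not at hrec
    obtain ⟨M, hM⟩ := hrec
    refine ENNReal.tsum_half_pow_eq_top_of_le (M := M + 1) fun n => diagonalDepth_le ?_
    intro j hj hjn hc
    by_contra! hle
    exact hM j hj (h.isTableauOver.anti hle hc)
  choose k l hk hl hkl hkc hlc using h.exists_second_child hrec hap
  have huniq : ∀ n n' i i', 0 < i → 0 < i' → crit n i → crit n' i' →
      (∀ j, 0 < j → j < i → ¬ crit (n + i - j) j) →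
      (∀ j, 0 < j → j < i' → ¬ crit (n' + i' - j) j) → n + i = n' + i' → i = i' := by
    intro n n' i i' hi hi' hc hc' hch hch' heq
    rcases lt_trichotomy i i' with h1 | h1 | h1
    · exact absurd (by convert hc using 1; omega) (hch' i hi h1)
    · exact h1
    · exact absurd (by convert hc' using 1; omega) (hch i' hi' h1)
  set φ : Option (ℕ ⊕ ℕ) → ℕ := fun o => match o with
    | none => 0
    | some (Sum.inl n) => n + k n
    | some (Sum.inr n) => n + l n with hφ
  have hφi : Injective φ := by
    rintro (_ | n | n) (_ | n' | n') heq
    · rfl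
    · have := hk n'; simp only [hφ] at heq; omega
    · have := hl n'; simp only [hφ] at heq; omega
    · have := hk n; simp only [hφ] at heq; omega
    · simp only [hφ] at heq
      have := huniq n n' _ _ (hk n) (hk n') (hkc n).1 (hkc n').1 (hkc n).2 (hkc n').2 heq
      have : n = n' := by omega
      rw [this]
    · simp only [hφ] at heq
      have := huniq n n' _ _ (hk n) (hl n') (hkc n).1 (hlc n').1 (hkc n).2 (hlc n').2 heq
      have e : n = n' := by omega
      subst e
      exact absurd this (hkl n)
    · have := hl n; simp only [hφ] at heq; omega
    · simp only [hφ] at heq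
      have := huniq n n' _ _ (hl n) (hk n') (hlc n).1 (hkc n').1 (hlc n).2 (hkc n').2 heq
      have e : n = n' := by omega
      subst e
      exact absurd this.symm (hkl n)
    · simp only [hφ] at heq
      have := huniq n n' _ _ (hl n) (hl n') (hlc n).1 (hlc n').1 (hlc n).2 (hlc n').2 heq
      have : n = n' := by omega
      rw [this]
  set w : ℕ → ℝ≥0∞ := fun n => 2⁻¹ ^ diagonalDepth crit n with hw
  have h1 : ∑' o, w (φ o) ≤ ∑' n, w n := ENNReal.tsum_comp_le_tsum_of_injective hφi w
  have hwk : ∀ n, w (n + k n) = 2⁻¹ * w n := fun n => by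
    simp only [hw, h.diagonalDepth_child (hk n) (hkc n).1 (hkc n).2, pow_succ']
  have hwl : ∀ n, w (n + l n) = 2⁻¹ * w n := fun n => by
    simp only [hw, h.diagonalDepth_child (hl n) (hlc n).1 (hlc n).2, pow_succ']
  have h2 : ∑' o, w (φ o) = 1 + ∑' n, w n := by
    have e1 : ∑' o, w (φ o) = w (φ none) + ∑' x : ℕ ⊕ ℕ, w (φ (some x)) := by
      rw [← (Equiv.optionEquivSumPUnit.{0} (ℕ ⊕ ℕ)).symm.tsum_eq,
        ENNReal.summable.tsum_sum ENNReal.summable, add_comm]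
      simp
    have e2 : ∑' x : ℕ ⊕ ℕ, w (φ (some x)) = ∑' n, w (n + k n) + ∑' n, w (n + l n) :=
      ENNReal.summable.tsum_sum ENNReal.summable
    rw [e1, e2]
    simp only [hwk, hwl, ENNReal.tsum_mul_left]
    rw [← add_mul, ENNReal.inv_two_add_inv_two, one_mul]
    simp [hφ, hw, diagonalDepth]
  rw [h2] at h1
  by_contra hne
  exact absurd h1 (not_le.2 (by
    rw [add_comm]; exact ENNReal.lt_add_right hne one_ne_zero))

/-- Divergence for an arbitrary point. -/
theorem tsum_eq_top_of_isTableauOver (h : IsCriticalTableau crit)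
    (hap : ∀ k, 0 < k → ∃ n, ¬ crit n k)
    {crit' : ℕ → ℕ → Prop} (h' : IsTableauOver crit crit') :
    ∑' n, (2⁻¹ : ℝ≥0∞) ^ diagonalDepth crit' n = ∞ := by
  classical
  by_cases hrec : ∀ M, ∃ j, crit' M j
  swap
  · push Not at hrec
    obtain ⟨M, hM⟩ := hrec
    refine ENNReal.tsum_half_pow_eq_top_of_le (M := M + 1) fun n => diagonalDepth_le ?_
    intro j _ _ hc
    by_contra! hle
    exact hM j (h'.anti hle hc)
  set j : ℕ → ℕ := fun M => Nat.find (hrec M) with hj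
  have hjs : ∀ M, crit' M (j M) := fun M => Nat.find_spec (hrec M)
  have hjm : ∀ M i, i < j M → ¬ crit' M i := fun M i hi => Nat.find_min (hrec M) hi
  have hmono : ∀ M, j M ≤ j (M + 1) := fun M => by
    by_contra! hlt
    exact hjm M _ hlt (h'.mono _ _ (hjs (M + 1)))
  have hinj : StrictMono fun M => j M + M := strictMono_nat_of_lt_succ fun M => by
    have := hmono M
    show j M + M < j (M + 1) + (M + 1)
    omega
  have hdepth : ∀ M, diagonalDepth crit' (j M + M) = diagonalDepth crit M := fun M => by
    rw [h'.diagonalDepth_add (hjs M), Finset.sum_eq_zero, zero_add]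
    intro i hi
    have hi' := Finset.mem_range.1 hi
    rw [if_neg]
    exact fun hc => hjm M i hi' (h'.anti (by omega) hc)
  have h1 := ENNReal.tsum_comp_le_tsum_of_injective hinj.injective
    fun n => (2⁻¹ : ℝ≥0∞) ^ diagonalDepth crit' n
  simp only [hdepth, h.tsum_eq_top hap] at h1
  exact top_le_iff.1 h1

end IsCriticalTableau

theorem IsPuzzle.piece_iterate_eq {f : ℂ → ℂ} {U : Set ℂ} (h : IsPuzzle f U) {n i : ℕ} {x y : ℂ}
    (hx : f^[n + i] x ∈ U) (hxy : y ∈ piece f U (n + i) x) :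
    piece f U n (f^[i] x) = piece f U n (f^[i] y) := by
  have hy : f^[n + i] y ∈ U := piece_subset hxy
  rw [← h.image_iterate_piece i hx, ← h.image_iterate_piece i hy, piece_eq hxy]

namespace IsCubicPuzzle

variable {f : ℂ → ℂ} {U : Set ℂ} {c e : ℂ}

theorem mem_piece_of_apply_eq (h : IsCubicPuzzle f U c e) {n : ℕ} {x y : ℂ} (hx : x ∈ piece f U 1 c)
    (hy : y ∈ piece f U (n + 1) c) (hxy : f x = f y) : x ∈ piece f U (n + 1) c := by
  have hc := h.mem_U (n + 1)
  have hyU : f^[n + 1] y ∈ U := piece_subset hy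
  have hxU : f^[n + 1] x ∈ U := by
    rw [iterate_succ_apply, hxy, ← iterate_succ_apply]; exact hyU
  have hmem : f c ∈ f '' piece f U (n + 1) x := by
    rw [h.image_piece_succ hxU, hxy, ← h.image_piece_succ hyU, ← piece_eq hy]
    exact mem_image_of_mem f (mem_piece hc)
  obtain ⟨u, hu, hu'⟩ := hmem
  have hu1 : u ∈ piece f U 1 c := by
    rw [piece_eq hx]
    exact h.piece_antitone x (by omega : 1 ≤ n + 1) hu
  rw [h.eq_of_apply_eq u hu1 hu'] at hu
  exact mem_piece_comm hu

theorem injOn_iterate (h : IsCubicPuzzle f U c e) (k : ℕ) {n : ℕ} {z : ℂ} (hz : f^[n + k] z ∈ U)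
    (hk : ∀ i < k, c ∉ piece f U (n + k - i) (f^[i] z)) :
    InjOn f^[k] (piece f U (n + k) z) := by
  induction k generalizing z with
  | zero => exact injOn_id _
  | succ k ih =>
    have h1 : InjOn f (piece f U (n + k + 1) z) := h.injOn _ _ (hk 0 (by omega))
    have h2 : InjOn f^[k] (piece f U (n + k) (f z)) := by
      refine ih hz fun i hi => ?_
      have := hk (i + 1) (by omega)
      rwa [show n + (k + 1) - (i + 1) = n + k - i by omega] at this
    rw [iterate_succ]
    refine h2.comp h1 ?_
    rw [← h.image_piece_succ (n := n + k) (z := z) hz]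
    exact mapsTo_image _ _

theorem isTableauOver (h : IsCubicPuzzle f U c e) {z : ℂ} (hz : ∀ n, f^[n] z ∈ U) :
    IsTableauOver (fun n j => c ∈ piece f U n (f^[j] c))
      (fun n j => c ∈ piece f U n (f^[j] z)) where
  mono n j hc := h.piece_antitone _ (Nat.le_succ n) hc
  transfer n i j m hc hmn := by
    have h1 : f^[n + i] (f^[j] z) ∈ U := by
      rw [← iterate_add_apply]; exact hz _
    have h2 := h.piece_iterate_eq (n := m) (i := i) (x := f^[j] z) (y := c)
      (h.preimage_antitone (by omega : m + i ≤ n + i) h1) (h.piece_antitone _ (by omega) hc)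
    rw [← iterate_add_apply, add_comm i j] at h2
    simp only [h2]

theorem isCriticalTableau (h : IsCubicPuzzle f U c e) :
    IsCriticalTableau (fun n j => c ∈ piece f U n (f^[j] c)) where
  zero_time n := mem_piece (h.mem_U n)
  mono := (h.isTableauOver h.mem_U).mono
  transfer := (h.isTableauOver h.mem_U).transfer
  ascend n k s p hk hs hn hpk hpsk := by
    obtain ⟨k, rfl⟩ : ∃ k', k = k' + 1 := ⟨k - 1, by omega⟩
    have hmem : ∀ n i, f^[n] (f^[i] c) ∈ U := fun n i => by
      rw [← iterate_add_apply]; exact h.mem_U _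
    have e1 := h.image_iterate_piece (k + 1) (n := n + p) (z := c) (h.mem_U _)
    have h1 : f^[k + 1] (f^[s] c) ∈ piece f U (n + p) (f^[k + 1] c) := by
      rw [← iterate_add_apply, add_comm (k + 1) s, ← piece_eq (mem_piece_comm hpk)]
      exact mem_piece_comm hpsk
    rw [← e1] at h1
    obtain ⟨y, hy, hy'⟩ := h1
    have hle : n + (k + 1) ≤ n + p + (k + 1) := by omega
    have hsk : f^[s] c ∈ piece f U (n + (k + 1)) c := mem_piece_comm hs
    have hyn : y ∈ piece f U (n + (k + 1)) c := h.piece_antitone _ hle hy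
    have hfx : f (f^[s] c) ∈ piece f U (n + k) (f c) := by
      rw [← h.image_piece_succ (n := n + k) (z := c) (h.mem_U _)]
      exact mem_image_of_mem f hsk
    have hfy : f y ∈ piece f U (n + k) (f c) := by
      rw [← h.image_piece_succ (n := n + k) (z := c) (h.mem_U _)]
      exact mem_image_of_mem f hyn
    have hinj : InjOn f^[k] (piece f U (n + k) (f c)) := by
      refine h.injOn_iterate k (hmem _ 1) fun i hi => ?_
      have := hn (i + 1) (by omega) (by omega)
      rwa [show n + (k + 1) - (i + 1) = n + k - i by omega] at this
    have hxy : f (f^[s] c) = f y := hinj hfx hfy hy'.symm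
    exact mem_piece_comm (h.mem_piece_of_apply_eq (n := n + p + k)
      (h.piece_antitone _ (by omega : 1 ≤ n + (k + 1)) hsk) hy hxy)

/-- If the orbit of `c` returns to all critical pieces after `k` steps, then the intersection of
the critical pieces is invariant under the `k`-th iterate. -/
theorem image_iInter_piece (h : IsCubicPuzzle f U c e)
    {k : ℕ} (hk : ∀ n, c ∈ piece f U n (f^[k] c)) :
    f^[k] '' (⋂ n, piece f U n c) = ⋂ n, piece f U n c := by
  have hc := h.continuous_iterate k
  have himg : ∀ n, f^[k] '' piece f U (n + k) c = piece f U n c := fun n => by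
    rw [h.image_iterate_piece k (h.mem_U _), piece_eq (hk n)]
  refine Subset.antisymm ?_ ?_
  · rintro _ ⟨x, hx, rfl⟩
    refine mem_iInter.2 fun n => ?_
    rw [← himg n]
    exact mem_image_of_mem _ (mem_iInter.1 hx (n + k))
  · intro y hy
    have hcl : ∀ n, closure (piece f U (n + 1) c) ⊆ piece f U n c := fun n => by
      refine isPreconnected_connectedComponentIn.closure.subset_connectedComponentIn
        (subset_closure (mem_piece (h.mem_U _)))
        ((closure_mono piece_subset).trans (h.closure_preimage_succ_subset n))
    set C : ℕ → Set ℂ := fun n => closure (piece f U (n + 1) c) ∩ f^[k] ⁻¹' {y} with hC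
    have hcpt : ∀ n, IsCompact (closure (piece f U n c)) := fun n => by
      refine (h.isBounded.subset ?_).isCompact_closure
      exact piece_subset.trans (h.preimage_antitone (Nat.zero_le n))
    have hne : (⋂ n, C n).Nonempty := by
      refine IsCompact.nonempty_iInter_of_sequence_nonempty_isCompact_isClosed C ?_ ?_ ?_ ?_
      · intro n
        exact inter_subset_inter_left _ (closure_mono (h.piece_antitone c (by omega)))
      · intro n
        have h1 : y ∈ piece f U (n + 1) c := mem_iInter.1 hy _
        rw [← himg] at h1
        obtain ⟨x, hx, hx'⟩ := h1
        exact ⟨x, subset_closure (h.piece_antitone c (by omega) hx), hx'⟩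
      · exact (hcpt _).inter_right (isClosed_singleton.preimage hc)
      · exact fun n => isClosed_closure.inter (isClosed_singleton.preimage hc)
    obtain ⟨x, hx⟩ := hne
    rw [mem_iInter] at hx
    exact ⟨x, mem_iInter.2 fun n => hcl n (hx n).1, (hx 0).2⟩

end IsCubicPuzzle

theorem HasDerivAt.abs_det_restrictScalars (w : ℂ) :
    ENNReal.ofReal |((ContinuousLinearMap.toSpanSingleton ℂ w).restrictScalars ℝ).det| =
      ‖w‖ₑ ^ 2 := by
  have : ((ContinuousLinearMap.toSpanSingleton ℂ w).restrictScalars ℝ).det = ‖w‖ ^ 2 := by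
    rw [ContinuousLinearMap.det, ContinuousLinearMap.coe_restrictScalars,
      LinearMap.det_restrictScalars]
    simp [Algebra.norm_complex_apply, Complex.normSq_eq_norm_sq]
  rw [this, abs_of_nonneg (by positivity), ENNReal.ofReal_pow (norm_nonneg _), ofReal_norm]

/-- Change of variables for a holomorphic map with at most `m` preimages of every point. -/
theorem lintegral_comp_mul_enorm_deriv_sq_le {f : ℂ → ℂ} (hf : Differentiable ℂ f)
    {P P' : Set ℂ} (hP' : IsOpen P') (hmaps : MapsTo f P' P) {m : ℕ}
    (hm : ∀ y, (P' ∩ f ⁻¹' {y}).encard ≤ m) {g : ℂ → ℝ≥0∞} (hg : Measurable g) :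
    ∫⁻ x in P', g (f x) * ‖deriv f x‖ₑ ^ 2 ≤ m * ∫⁻ y in P, g y := by
  classical
  have hcd : Continuous (deriv f) := (hf.contDiff (n := 1)).continuous_deriv le_rfl
  set S : Set ℂ := P' ∩ {x | deriv f x ≠ 0} with hS
  have hSm : MeasurableSet S :=
    (hP'.inter (isOpen_ne_fun hcd continuous_const)).measurableSet
  have hex : ∀ z : ℂ, ∃ O : Set ℂ, IsOpen O ∧ (z ∈ S → z ∈ O) ∧ InjOn f O := by
    intro z
    by_cases hz : z ∈ S
    · obtain ⟨O, h1, h2, h3⟩ := exists_isOpen_injOn_of_deriv_ne_zero hf hz.2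
      exact ⟨O, h1, fun _ => h2, h3⟩
    · exact ⟨∅, isOpen_empty, fun h => absurd h hz, injOn_empty f⟩
  choose O hO hzO hinj using hex
  obtain ⟨T, hTc, hT⟩ := TopologicalSpace.isOpen_iUnion_countable O hO
  obtain ⟨s, hs⟩ : ∃ s : ℕ → ℂ, T ⊆ range s := by
    rcases T.eq_empty_or_nonempty with rfl | hne
    · exact ⟨fun _ => 0, empty_subset _⟩
    · obtain ⟨s, rfl⟩ := hTc.exists_eq_range hne
      exact ⟨s, Subset.rfl⟩
  set E : ℕ → Set ℂ := fun i => S ∩ disjointed (fun i => O (s i)) i with hE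
  have hEm : ∀ i, MeasurableSet (E i) := fun i =>
    hSm.inter (MeasurableSet.disjointed (fun i => (hO (s i)).measurableSet) i)
  have hEd : Pairwise (Disjoint on E) := fun i j hij =>
    ((disjoint_disjointed (fun i => O (s i))) hij).mono inter_subset_right inter_subset_right
  have hEU : ⋃ i, E i = S := by
    rw [← inter_iUnion, iUnion_disjointed]
    refine inter_eq_left.2 fun z hz => ?_
    have : z ∈ ⋃ i ∈ T, O i := by rw [hT]; exact mem_iUnion.2 ⟨z, hzO z hz⟩
    obtain ⟨t, ht, hzt⟩ := mem_iUnion₂.1 this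
    obtain ⟨i, rfl⟩ := hs ht
    exact mem_iUnion.2 ⟨i, hzt⟩
  have hEinj : ∀ i, InjOn f (E i) := fun i =>
    (hinj (s i)).mono (inter_subset_right.trans (disjointed_subset _ i))
  have hfd : ∀ x, HasFDerivAt f
      ((ContinuousLinearMap.toSpanSingleton ℂ (deriv f x)).restrictScalars ℝ) x := fun x =>
    ((hf x).hasDerivAt.hasFDerivAt).restrictScalars ℝ
  have hfE : ∀ i, MeasurableSet (f '' E i) := fun i =>
    measurable_image_of_fderivWithin (hEm i) (fun x _ => (hfd x).hasFDerivWithinAt) (hEinj i)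
  have key : ∀ i, ∫⁻ x in E i, g (f x) * ‖deriv f x‖ₑ ^ 2 = ∫⁻ y in f '' E i, g y := fun i => by
    rw [lintegral_image_eq_lintegral_abs_det_fderiv_mul volume (hEm i)
      (fun x _ => (hfd x).hasFDerivWithinAt) (hEinj i)]
    refine lintegral_congr fun x => ?_
    rw [HasDerivAt.abs_det_restrictScalars, mul_comm]
  have hcount : ∀ y, ∑' i, (f '' E i).indicator (1 : ℂ → ℝ≥0∞) y ≤ m := by
    intro y
    rw [ENNReal.tsum_eq_iSup_sum]
    refine iSup_le fun t => ?_
    have e1 : ∑ i ∈ t, (f '' E i).indicator (1 : ℂ → ℝ≥0∞) y =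
        ((t.filter fun i => y ∈ f '' E i).card : ℝ≥0∞) := by
      simp [indicator_apply]
    rw [e1]
    have h1 : ∀ i ∈ t.filter fun i => y ∈ f '' E i, ∃ x ∈ E i, f x = y := fun i hi =>
      (Finset.mem_filter.1 hi).2
    choose! x hxE hxy using h1
    have hxinj : InjOn x (t.filter fun i => y ∈ f '' E i : Finset ℕ) := by
      intro i hi j hj hij
      by_contra hne
      exact disjoint_left.1 (hEd hne) (hxE i hi) (hij ▸ hxE j hj)
    have h2 : x '' (t.filter fun i => y ∈ f '' E i : Finset ℕ) ⊆ P' ∩ f ⁻¹' {y} := by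
      rintro _ ⟨i, hi, rfl⟩
      exact ⟨(hxE i hi).1.1, hxy i hi⟩
    have h3 := (encard_le_encard h2).trans (hm y)
    rw [hxinj.encard_image, encard_coe_eq_coe_finsetCard] at h3
    exact_mod_cast h3
  have hz : ∫⁻ x in P', g (f x) * ‖deriv f x‖ₑ ^ 2 = ∫⁻ x in S, g (f x) * ‖deriv f x‖ₑ ^ 2 := by
    rw [← lintegral_indicator hP'.measurableSet, ← lintegral_indicator hSm]
    congr 1
    ext x
    by_cases hxS : x ∈ S
    · rw [indicator_of_mem hxS, indicator_of_mem hxS.1]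
    rw [indicator_of_notMem hxS]
    by_cases hxP : x ∈ P'
    swap
    · rw [indicator_of_notMem hxP]
    have : deriv f x = 0 := by
      by_contra h
      exact hxS ⟨hxP, h⟩
    simp [this]
  have hsub : ∀ i, f '' E i ⊆ P := fun i => by
    rintro _ ⟨x, hx, rfl⟩
    exact hmaps hx.1.1
  calc ∫⁻ x in P', g (f x) * ‖deriv f x‖ₑ ^ 2
      = ∑' i, ∫⁻ x in E i, g (f x) * ‖deriv f x‖ₑ ^ 2 := by
        rw [hz, ← hEU, lintegral_iUnion hEm hEd]
    _ = ∑' i, ∫⁻ y in P, (f '' E i).indicator (1 : ℂ → ℝ≥0∞) y * g y := by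
        refine tsum_congr fun i => ?_
        rw [key]
        have : (fun y => (f '' E i).indicator (1 : ℂ → ℝ≥0∞) y * g y) = (f '' E i).indicator g := by
          ext y; by_cases h : y ∈ f '' E i <;> simp [h]
        rw [this, setLIntegral_indicator (hfE i), inter_eq_left.2 (hsub i)]
    _ = ∫⁻ y in P, (∑' i, (f '' E i).indicator (1 : ℂ → ℝ≥0∞) y) * g y := by
        rw [← lintegral_tsum]
        · simp_rw [ENNReal.tsum_mul_right]
        · exact fun i => ((measurable_one.indicator (hfE i)).mul hg).aemeasurable
    _ ≤ ∫⁻ y in P, m * g y := lintegral_mono fun y => mul_le_mul_left (hcount y) _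
    _ = m * ∫⁻ y in P, g y := lintegral_const_mul _ hg

open scoped Classical in
theorem diagonalDepth_succ (crit : ℕ → ℕ → Prop) (n : ℕ) :
    diagonalDepth crit (n + 1) =
      diagonalDepth (fun m j => crit m (j + 1)) n + if crit (n + 1) 0 then 1 else 0 := by
  rw [diagonalDepth, diagonalDepth, Finset.sum_range_succ']
  simp

theorem IsCubicPuzzle.lintegral_piece_le {f : ℂ → ℂ} {U : Set ℂ} {c e : ℂ}
    (h : IsCubicPuzzle f U c e) {φ : ℂ → ℝ≥0∞} (hφ : Measurable φ) (n : ℕ) {z : ℂ}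
    (hz : ∀ n, f^[n] z ∈ U) :
    ∫⁻ x in piece f U n z, φ (f^[n] x) * ‖deriv f^[n] x‖ₑ ^ 2 ≤
      2 ^ diagonalDepth (fun n j => c ∈ piece f U n (f^[j] z)) n * ∫⁻ x in U, φ x := by
  classical
  induction n generalizing z with
  | zero =>
    rw [h.piece_zero (show z ∈ U from hz 0)]
    simp [diagonalDepth, iterate_zero]
  | succ n ih =>
    have hfz : ∀ n, f^[n] (f z) ∈ U := fun n => hz (n + 1)
    have hd : Differentiable ℂ f^[n] := h.differentiable.iterate n
    have hcd : Continuous (deriv f^[n]) := (hd.contDiff (n := 1)).continuous_deriv le_rfl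
    set g : ℂ → ℝ≥0∞ := fun y => φ (f^[n] y) * ‖deriv f^[n] y‖ₑ ^ 2 with hg
    have hgm : Measurable g :=
      (hφ.comp hd.continuous.measurable).mul (hcd.enorm.measurable.pow_const 2)
    have e1 : ∀ x, φ (f^[n + 1] x) * ‖deriv f^[n + 1] x‖ₑ ^ 2 = g (f x) * ‖deriv f x‖ₑ ^ 2 := by
      intro x
      rw [iterate_succ, deriv_comp x (hd _) (h.differentiable x), enorm_mul, mul_pow, hg]
      simp only [comp_apply, mul_assoc]
    have hmaps : MapsTo f (piece f U (n + 1) z) (piece f U n (f z)) := by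
      rw [← h.image_piece_succ (hz (n + 1))]
      exact mapsTo_image _ _
    have hP' := h.isOpen_piece (n + 1) z
    simp_rw [e1]
    rw [diagonalDepth_succ]
    by_cases hc : c ∈ piece f U (n + 1) z
    · have hm : ∀ y, (piece f U (n + 1) z ∩ f ⁻¹' {y}).encard ≤ (2 : ℕ) := by
        intro y
        by_contra! hlt
        obtain ⟨x1, x2, x3, h1, h2, h3, h12, h13, h23⟩ :
            ∃ a b d, a ∈ piece f U (n + 1) z ∩ f ⁻¹' {y} ∧ b ∈ piece f U (n + 1) z ∩ f ⁻¹' {y} ∧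
              d ∈ piece f U (n + 1) z ∩ f ⁻¹' {y} ∧ a ≠ b ∧ a ≠ d ∧ b ≠ d := by
          obtain ⟨t, ht, ht3⟩ := exists_subset_encard_eq (Order.add_one_le_of_lt hlt)
          obtain ⟨a, b, d, h1, h2, h3, rfl⟩ := encard_eq_three.1 (ht3.trans (by norm_num))
          exact ⟨a, b, d, ht (by simp), ht (by simp), ht (by simp), h1, h2, h3⟩
        have hsub : piece f U (n + 1) z ⊆ piece f U 1 c := by
          rw [piece_eq hc]
          exact h.piece_antitone c (by omega)
        rcases h.two_to_one x1 (hsub h1.1) x2 (hsub h2.1) x3 (hsub h3.1) (h1.2.trans h2.2.symm)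
          (h1.2.trans h3.2.symm) with h' | h' | h'
        · exact h12 h'
        · exact h13 h'
        · exact h23 h'
      refine (lintegral_comp_mul_enorm_deriv_sq_le h.differentiable hP' hmaps hm hgm).trans ?_
      refine (mul_le_mul_right (ih hfz) _).trans (le_of_eq ?_)
      rw [if_pos (by simpa using hc)]
      simp only [pow_succ,
        iterate_succ_apply]
      push_cast
      ring
    · have hm : ∀ y, (piece f U (n + 1) z ∩ f ⁻¹' {y}).encard ≤ (1 : ℕ) := by
        intro y
        refine encard_le_one_iff.2 fun a b ha hb => h.injOn n z hc ha.1 hb.1 ?_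
        exact (show f a = y from ha.2).trans (show f b = y from hb.2).symm
      refine (lintegral_comp_mul_enorm_deriv_sq_le h.differentiable hP' hmaps hm hgm).trans ?_
      refine (mul_le_mul_right (ih hfz) _).trans (le_of_eq ?_)
      rw [if_neg (by simpa using hc)]
      simp only [add_zero, iterate_succ_apply]
      push_cast
      ring

theorem le_lintegral_enorm_deriv_sq {v : ℝ → ℝ} (hv : ContDiff ℝ 1 v) {R y : ℝ} (hR : 0 < R)
    (hy : -R ≤ y) (hy' : y ≤ R) (h0 : v (-R) = 0) (h1 : v y = 1) :
    ENNReal.ofReal (1 / (2 * R)) ≤ ∫⁻ t, ‖deriv v t‖ₑ ^ 2 := by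
  have hc : Continuous (deriv v) := hv.continuous_deriv le_rfl
  have h_int : ∫ t in (-R)..y, deriv v t = 1 := by
    rw [intervalIntegral.integral_deriv_eq_sub (fun x _ => (hv.differentiable one_ne_zero) x)
      (hc.intervalIntegrable _ _), h0, h1, sub_zero]
  have hsq : 0 ≤ ∫ t in (-R)..y, (2 * R * deriv v t - 1) ^ 2 :=
    intervalIntegral.integral_nonneg hy fun t _ => sq_nonneg _
  have hexp : ∫ t in (-R)..y, (2 * R * deriv v t - 1) ^ 2 =
      4 * R ^ 2 * (∫ t in (-R)..y, deriv v t ^ 2) - 4 * R * 1 + (y + R) := by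
    have : ∀ t, (2 * R * deriv v t - 1) ^ 2 =
        4 * R ^ 2 * deriv v t ^ 2 - 4 * R * deriv v t + 1 := fun t => by ring
    simp_rw [this]
    rw [intervalIntegral.integral_add, intervalIntegral.integral_sub,
      intervalIntegral.integral_const_mul, intervalIntegral.integral_const_mul, h_int]
    · simp
    all_goals exact Continuous.intervalIntegrable (by fun_prop) _ _
  have hle : 1 / (2 * R) ≤ ∫ t in (-R)..y, deriv v t ^ 2 := by
    rw [div_le_iff₀ (by positivity)]
    nlinarith
  calc ENNReal.ofReal (1 / (2 * R)) ≤ ENNReal.ofReal (∫ t in (-R)..y, deriv v t ^ 2) :=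
        ENNReal.ofReal_le_ofReal hle
    _ = ∫⁻ t in Ioc (-R) y, ENNReal.ofReal (deriv v t ^ 2) := by
        rw [intervalIntegral.integral_of_le hy]
        refine ofReal_integral_eq_lintegral_ofReal ?_ (ae_of_all _ fun t => sq_nonneg _)
        exact (Continuous.intervalIntegrable (by fun_prop) _ _ : IntervalIntegrable
          (fun t => deriv v t ^ 2) volume (-R) y).1
    _ = ∫⁻ t in Ioc (-R) y, ‖deriv v t‖ₑ ^ 2 := by
        refine lintegral_congr fun t => ?_
        rw [← sq_abs, ENNReal.ofReal_pow (abs_nonneg _), ← Real.norm_eq_abs, ofReal_norm]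
    _ ≤ ∫⁻ t, ‖deriv v t‖ₑ ^ 2 := setLIntegral_le_lintegral _ _

theorem le_lintegral_enorm_fderiv_sq {u : ℂ → ℝ} (hu : ContDiff ℝ 1 u) {R : ℝ} (hR : 0 < R)
    (h0 : ∀ z, R ≤ ‖z‖ → u z = 0) {X : Set ℂ} (hX : IsPreconnected X) (h1 : ∀ z ∈ X, u z = 1)
    {p q : ℂ} (hp : p ∈ X) (hq : q ∈ X) :
    ENNReal.ofReal (1 / (2 * R)) * ENNReal.ofReal (q.re - p.re) ≤
      ∫⁻ z, ‖fderiv ℝ u z‖ₑ ^ 2 := by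
  have hcd : Continuous (fderiv ℝ u) := hu.continuous_fderiv one_ne_zero
  have hmp := Complex.volume_preserving_equiv_real_prod.symm
  have hm : Measurable fun z => ‖fderiv ℝ u z‖ₑ ^ 2 := hcd.enorm.measurable.pow_const 2
  rw [← hmp.lintegral_comp hm, Measure.volume_eq_prod, lintegral_prod]
  swap
  · exact (hm.comp Complex.measurableEquivRealProd.symm.measurable).aemeasurable
  have key : ∀ x ∈ Icc p.re q.re, ENNReal.ofReal (1 / (2 * R)) ≤
      ∫⁻ y, ‖fderiv ℝ u (Complex.measurableEquivRealProd.symm (x, y))‖ₑ ^ 2 := by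
    intro x hx
    have hpre := (hX.image Complex.re Complex.continuous_re.continuousOn)
    obtain ⟨w, hw, rfl⟩ := hpre.Icc_subset (mem_image_of_mem _ hp) (mem_image_of_mem _ hq) hx
    set ℓ : ℝ → ℂ := fun y => (w.re : ℂ) + y * Complex.I with hℓ
    have hℓd : ∀ y, HasDerivAt ℓ Complex.I y := fun y => by
      have := ((hasDerivAt_id (y : ℝ)).ofReal_comp.mul_const Complex.I).const_add (w.re : ℂ)
      simpa [hℓ] using this
    have hℓc : ContDiff ℝ 1 ℓ := by
      have : ContDiff ℝ 1 (fun y : ℝ => (y : ℂ)) := Complex.ofRealCLM.contDiff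
      exact contDiff_const.add (this.mul contDiff_const)
    have hd : ∀ y, HasDerivAt (u ∘ ℓ) (fderiv ℝ u (ℓ y) Complex.I) y := fun y =>
      ((hu.differentiable one_ne_zero) (ℓ y)).hasFDerivAt.comp_hasDerivAt y (hℓd y)
    have hwR : ‖w‖ < R := by
      by_contra! hle
      have := h0 w hle
      rw [h1 w hw] at this
      exact one_ne_zero this
    have him := abs_le.1 ((Complex.abs_im_le_norm w).trans hwR.le)
    have hw' : ℓ w.im = w := Complex.re_add_im w
    refine (le_lintegral_enorm_deriv_sq (hu.comp hℓc) hR him.1 him.2 ?_ ?_).trans ?_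
    · refine h0 _ ?_
      have := Complex.abs_im_le_norm (ℓ (-R))
      simp only [hℓ, Complex.add_im, Complex.ofReal_im, Complex.mul_im, Complex.ofReal_re,
        Complex.I_im, Complex.I_re] at this
      simp only [mul_one, mul_zero, add_zero, zero_add, abs_neg, abs_of_pos hR] at this
      exact this
    · rw [comp_apply, hw', h1 w hw]
    · refine lintegral_mono fun y => ?_
      have e : Complex.measurableEquivRealProd.symm (w.re, y) = ℓ y := by
        apply Complex.ext <;> simp [hℓ, Complex.measurableEquivRealProd]
      rw [e, (hd y).deriv]
      gcongr
      rw [← ofReal_norm, ← ofReal_norm]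
      refine ENNReal.ofReal_le_ofReal ?_
      simpa using (fderiv ℝ u (ℓ y)).le_opNorm Complex.I
  calc ENNReal.ofReal (1 / (2 * R)) * ENNReal.ofReal (q.re - p.re)
      = ∫⁻ _ in Icc p.re q.re, ENNReal.ofReal (1 / (2 * R)) := by
        rw [setLIntegral_const, Real.volume_Icc]
    _ ≤ ∫⁻ x in Icc p.re q.re,
          ∫⁻ y, ‖fderiv ℝ u (Complex.measurableEquivRealProd.symm (x, y))‖ₑ ^ 2 :=
        setLIntegral_mono' measurableSet_Icc key
    _ ≤ _ := setLIntegral_le_lintegral _ _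

/-- A nondegenerate continuum has positive capacity: the Dirichlet energy of functions equal to
one on it and vanishing off a fixed ball is bounded below. -/
theorem exists_pos_le_lintegral_enorm_fderiv_sq {R : ℝ} (hR : 0 < R) {X : Set ℂ}
    (hX : IsPreconnected X) (hX' : X.Nontrivial) :
    ∃ δ : ℝ≥0∞, 0 < δ ∧ ∀ u : ℂ → ℝ, ContDiff ℝ 1 u → (∀ z, R ≤ ‖z‖ → u z = 0) →
      (∀ z ∈ X, u z = 1) → δ ≤ ∫⁻ z, ‖fderiv ℝ u z‖ₑ ^ 2 := by
  obtain ⟨p, hp, q, hq, hpq⟩ := hX'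
  have hpos : 0 < ENNReal.ofReal (1 / (2 * R)) := ENNReal.ofReal_pos.2 (by positivity)
  have hre : ∀ p ∈ X, ∀ q ∈ X, p.re < q.re → ∃ δ : ℝ≥0∞, 0 < δ ∧ ∀ u : ℂ → ℝ, ContDiff ℝ 1 u →
      (∀ z, R ≤ ‖z‖ → u z = 0) → (∀ z ∈ X, u z = 1) → δ ≤ ∫⁻ z, ‖fderiv ℝ u z‖ₑ ^ 2 :=
    fun p hp q hq hlt => ⟨_, ENNReal.mul_pos hpos.ne' (ENNReal.ofReal_pos.2 (sub_pos.2 hlt)).ne',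
      fun u hu h0 h1 => le_lintegral_enorm_fderiv_sq hu hR h0 hX h1 hp hq⟩
  have him : ∀ p ∈ X, ∀ q ∈ X, p.im < q.im → ∃ δ : ℝ≥0∞, 0 < δ ∧ ∀ u : ℂ → ℝ, ContDiff ℝ 1 u →
      (∀ z, R ≤ ‖z‖ → u z = 0) → (∀ z ∈ X, u z = 1) → δ ≤ ∫⁻ z, ‖fderiv ℝ u z‖ₑ ^ 2 := by
    intro p hp q hq hlt
    refine ⟨_, ENNReal.mul_pos hpos.ne' (ENNReal.ofReal_pos.2 (sub_pos.2 hlt)).ne',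
      fun u hu h0 h1 => ?_⟩
    let L : ℂ ≃ₗᵢ[ℝ] ℂ :=
      (rotation (⟨Complex.I, by simp [Submonoid.unitSphere]⟩ : Circle))
    have hL : ∀ z, L z = Complex.I * z := fun z => rotation_apply _ _
    have hXL : IsPreconnected ((fun z => -Complex.I * z) '' X) :=
      hX.image _ (by fun_prop)
    have hII : ∀ z : ℂ, Complex.I * (-Complex.I * z) = z := fun z => by
      rw [← mul_assoc]; simp
    have := le_lintegral_enorm_fderiv_sq (u := u ∘ L) (hu.comp L.contDiff) hR
      (fun z hz => h0 _ (by simpa using hz)) hXL (p := -Complex.I * p) (q := -Complex.I * q) ?_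
      (mem_image_of_mem _ hp) (mem_image_of_mem _ hq)
    · have e : ∀ z : ℂ, (-Complex.I * z).re = z.im := fun z => by simp
      rw [e, e] at this
      refine this.trans ?_
      have hcd : Continuous (fderiv ℝ u) := hu.continuous_fderiv one_ne_zero
      have hm : Measurable fun z => ‖fderiv ℝ u z‖ₑ ^ 2 := hcd.enorm.measurable.pow_const 2
      rw [← L.measurePreserving.lintegral_comp hm]
      refine lintegral_mono fun z => ?_
      gcongr
      rw [← ofReal_norm, ← ofReal_norm]
      refine ENNReal.ofReal_le_ofReal ?_
      rw [fderiv_comp z ((hu.differentiable one_ne_zero) _) L.differentiable.differentiableAt]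
      refine (ContinuousLinearMap.opNorm_comp_le _ _).trans ?_
      refine mul_le_of_le_one_right (norm_nonneg _) ?_
      rw [show fderiv ℝ (⇑L) z = (L.toContinuousLinearEquiv : ℂ →L[ℝ] ℂ) from
        L.toContinuousLinearEquiv.fderiv]
      exact ContinuousLinearMap.opNorm_le_bound _ zero_le_one fun w => by simp
    · rintro _ ⟨z, hz, rfl⟩
      rw [comp_apply, hL, hII, h1 z hz]
  rcases lt_trichotomy p.re q.re with h | h | h
  · exact hre p hp q hq h
  · rcases lt_trichotomy p.im q.im with h' | h' | h'
    · exact him p hp q hq h'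
    · exact absurd (Complex.ext h h') hpq
    · exact him q hq p hp h'
  · exact hre q hq p hp h

theorem enorm_sum_sq_le_of_unique {E ι : Type*} [SeminormedAddCommGroup E] (s : Finset ι)
    (v : ι → E) (hv : ∀ i ∈ s, ∀ j ∈ s, v i ≠ 0 → v j ≠ 0 → i = j) :
    ‖∑ i ∈ s, v i‖ₑ ^ 2 ≤ ∑ i ∈ s, ‖v i‖ₑ ^ 2 := by
  by_cases h : ∃ i ∈ s, v i ≠ 0
  · obtain ⟨i, hi, hvi⟩ := h
    rw [Finset.sum_eq_single_of_mem i hi fun j hj hji => by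
      by_contra hne
      exact hji (hv j hj i hi hne hvi)]
    exact Finset.single_le_sum (f := fun i => ‖v i‖ₑ ^ 2) (fun _ _ => zero_le) hi
  · push Not at h
    rw [Finset.sum_eq_zero h, ← ofReal_norm, norm_zero]
    simp

theorem ENNReal.ofReal_sum_half_pow (k : ℕ → ℕ) (s : Finset ℕ) :
    ∑ n ∈ s, (2⁻¹ : ℝ≥0∞) ^ k n = ENNReal.ofReal (∑ n ∈ s, (2⁻¹ : ℝ) ^ k n) := by
  rw [ENNReal.ofReal_sum_of_nonneg fun n _ => by positivity]
  refine Finset.sum_congr rfl fun n _ => ?_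
  rw [ENNReal.ofReal_pow (by norm_num), ENNReal.ofReal_inv_of_pos (by norm_num)]
  simp

theorem ENNReal.ofReal_half_pow_div_sq_mul {S : ℝ} (hS : 0 < S) (k : ℕ) :
    ENNReal.ofReal ((2⁻¹ : ℝ) ^ k / S) ^ 2 * 2 ^ k = ENNReal.ofReal ((2⁻¹ : ℝ) ^ k / S ^ 2) := by
  have e2 : (2 : ℝ≥0∞) ^ k = ENNReal.ofReal (2 ^ k) := by
    rw [ENNReal.ofReal_pow (by norm_num)]
    simp
  rw [e2, ← ENNReal.ofReal_pow (by positivity), ← ENNReal.ofReal_mul (by positivity)]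
  congr 1
  have : (2⁻¹ : ℝ) ^ k * 2 ^ k = 1 := by simp
  rw [div_pow, div_mul_eq_mul_div, sq ((2⁻¹ : ℝ) ^ k), mul_assoc, this, mul_one]

/-- Energy of a convex combination of functions with disjointly supported derivatives. -/
theorem mul_sum_le_of_energy_le {δ E : ℝ≥0∞} {R : ℝ} {X : Set ℂ}
    (henergy : ∀ u : ℂ → ℝ, ContDiff ℝ 1 u → (∀ z, R ≤ ‖z‖ → u z = 0) →
      (∀ z ∈ X, u z = 1) → δ ≤ ∫⁻ z, ‖fderiv ℝ u z‖ₑ ^ 2)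
    {v : ℕ → ℂ → ℝ} (hvc : ∀ n, ContDiff ℝ 1 (v n))
    (hvd : ∀ i j x, fderiv ℝ (v i) x ≠ 0 → fderiv ℝ (v j) x ≠ 0 → i = j) {k : ℕ → ℕ}
    (hvE : ∀ n, ∫⁻ x, ‖fderiv ℝ (v n) x‖ₑ ^ 2 ≤ 2 ^ k n * E)
    (hv1 : ∀ n, ∀ x ∈ X, v n x = 1) (hv0 : ∀ n x, R ≤ ‖x‖ → v n x = 0) (M : ℕ) :
    δ * ∑ n ∈ Finset.range M, (2⁻¹ : ℝ≥0∞) ^ k n ≤ E := by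
  rcases Nat.eq_zero_or_pos M with rfl | hM
  · simp
  rw [ENNReal.ofReal_sum_half_pow]
  set S : ℝ := ∑ n ∈ Finset.range M, (2⁻¹ : ℝ) ^ k n with hS
  have hSpos : 0 < S := Finset.sum_pos (fun n _ => by positivity) ⟨0, Finset.mem_range.2 hM⟩
  have htpos : ∀ n, 0 < (2⁻¹ : ℝ) ^ k n / S := fun n => by positivity
  have hsum1 : ∑ n ∈ Finset.range M, (2⁻¹ : ℝ) ^ k n / S = 1 := by
    rw [← Finset.sum_div, div_self hSpos.ne']
  set w : ℂ → ℝ := fun x => ∑ n ∈ Finset.range M, (2⁻¹ : ℝ) ^ k n / S * v n x with hw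
  have hwc : ContDiff ℝ 1 w := ContDiff.sum fun n _ => contDiff_const.mul (hvc n)
  have hwd : ∀ x, fderiv ℝ w x =
      ∑ n ∈ Finset.range M, ((2⁻¹ : ℝ) ^ k n / S) • fderiv ℝ (v n) x := by
    intro x
    have hd : ∀ n, DifferentiableAt ℝ (v n) x := fun n =>
      ((hvc n).differentiable one_ne_zero) x
    rw [hw, fderiv_fun_sum fun n _ => (hd n).const_mul _]
    exact Finset.sum_congr rfl fun n _ => fderiv_const_mul (hd n) _
  have hw1 : ∀ x ∈ X, w x = 1 := fun x hx => by
    rw [← hsum1]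
    exact Finset.sum_congr rfl fun n _ => by rw [hv1 n x hx, mul_one]
  have hw0 : ∀ x, R ≤ ‖x‖ → w x = 0 := fun x hx =>
    Finset.sum_eq_zero fun n _ => by rw [hv0 n x hx, mul_zero]
  have hpt : ∀ x, ‖fderiv ℝ w x‖ₑ ^ 2 ≤ ∑ n ∈ Finset.range M,
      ENNReal.ofReal ((2⁻¹ : ℝ) ^ k n / S) ^ 2 * ‖fderiv ℝ (v n) x‖ₑ ^ 2 := by
    intro x
    rw [hwd]
    refine (enorm_sum_sq_le_of_unique _ _ fun i _ j _ hi hj =>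
      hvd i j x (right_ne_zero_of_smul hi) (right_ne_zero_of_smul hj)).trans_eq ?_
    refine Finset.sum_congr rfl fun n _ => ?_
    rw [enorm_smul, mul_pow, Real.enorm_of_nonneg (htpos n).le]
  have hle : δ ≤ ENNReal.ofReal (1 / S) * E := by
    refine (henergy w hwc hw0 hw1).trans ((lintegral_mono hpt).trans ?_)
    rw [lintegral_finsetSum']
    · have h1 : ∀ n, ∫⁻ x, ENNReal.ofReal ((2⁻¹ : ℝ) ^ k n / S) ^ 2 * ‖fderiv ℝ (v n) x‖ₑ ^ 2 ≤
          ENNReal.ofReal ((2⁻¹ : ℝ) ^ k n / S ^ 2) * E := fun n => by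
        rw [lintegral_const_mul' _ _ (by finiteness), ← ENNReal.ofReal_half_pow_div_sq_mul hSpos,
          mul_assoc]
        exact mul_le_mul_right (hvE n) _
      refine (Finset.sum_le_sum fun n _ => h1 n).trans_eq ?_
      rw [← Finset.sum_mul, ← ENNReal.ofReal_sum_of_nonneg fun n _ => by positivity,
        ← Finset.sum_div, ← hS]
      congr 2
      field_simp
    · intro n _
      have : Continuous (fderiv ℝ (v n)) := (hvc n).continuous_fderiv one_ne_zero
      exact ((this.enorm.measurable.pow_const 2).const_mul _).aemeasurable
  calc δ * ENNReal.ofReal S ≤ ENNReal.ofReal (1 / S) * E * ENNReal.ofReal S :=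
        mul_le_mul_left hle _
    _ = E := by
        rw [mul_right_comm, ← ENNReal.ofReal_mul (by positivity), one_div,
          inv_mul_cancel₀ hSpos.ne']
        simp

namespace IsCubicPuzzle

variable {f : ℂ → ℂ} {U : Set ℂ} {c e : ℂ}

theorem eventually_notMem_piece (h : IsCubicPuzzle f U c e)
    {n : ℕ} {x z : ℂ} (hx : f^[n] x ∈ U) (hxz : x ∉ piece f U n z) :
    ∀ᶠ y in 𝓝 x, y ∉ piece f U n z := by
  filter_upwards [(h.isOpen_piece n x).mem_nhds (mem_piece hx)] with y hy hyz
  exact hxz (by rw [piece_eq hyz, ← piece_eq hy]; exact mem_piece hx)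

theorem exists_eventuallyEq_piece (h : IsCubicPuzzle f U c e)
    {u : ℂ → ℝ} (hu0 : ∀ x ∉ U, ∀ᶠ y in 𝓝 x, u y = 0)
    (n : ℕ) (z x : ℂ) :
    (x ∈ piece f U n z ∧ (piece f U n z).indicator (u ∘ f^[n]) =ᶠ[𝓝 x] u ∘ f^[n]) ∨
      (piece f U n z).indicator (u ∘ f^[n]) =ᶠ[𝓝 x] fun _ => 0 := by
  by_cases hx : x ∈ piece f U n z
  · refine Or.inl ⟨hx, ?_⟩
    filter_upwards [(h.isOpen_piece n z).mem_nhds hx] with y hy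
    rw [indicator_of_mem hy]
  · right
    by_cases hxU : f^[n] x ∈ U
    · filter_upwards [h.eventually_notMem_piece hxU hx] with y hy
      rw [indicator_of_notMem hy]
    · filter_upwards [(h.continuous_iterate n).continuousAt.eventually (hu0 _ hxU)] with y hy
      by_cases hyp : y ∈ piece f U n z
      · rw [indicator_of_mem hyp]; exact hy
      · rw [indicator_of_notMem hyp]

theorem contDiff_indicator_piece (h : IsCubicPuzzle f U c e) {u : ℂ → ℝ} (hu : ContDiff ℝ 1 u)
    (hu0 : ∀ x ∉ U, ∀ᶠ y in 𝓝 x, u y = 0) (n : ℕ) (z : ℂ) :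
    ContDiff ℝ 1 ((piece f U n z).indicator (u ∘ f^[n])) := by
  have hfn : ContDiff ℝ 1 f^[n] :=
    ((h.differentiable.iterate n).contDiff (n := 1)).restrict_scalars ℝ
  refine contDiff_iff_contDiffAt.2 fun x => ?_
  rcases h.exists_eventuallyEq_piece hu0 n z x with ⟨_, h1⟩ | h1
  · exact (hu.comp hfn).contDiffAt.congr_of_eventuallyEq h1
  · exact contDiffAt_const.congr_of_eventuallyEq h1

theorem enorm_fderiv_indicator_piece_le (h : IsCubicPuzzle f U c e)
    {u : ℂ → ℝ} (hu : ContDiff ℝ 1 u)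
    (hu0 : ∀ x ∉ U, ∀ᶠ y in 𝓝 x, u y = 0) (n : ℕ) (z x : ℂ) :
    ‖fderiv ℝ ((piece f U n z).indicator (u ∘ f^[n])) x‖ₑ ^ 2 ≤
      (piece f U n z).indicator
        (fun x => ‖fderiv ℝ u (f^[n] x)‖ₑ ^ 2 * ‖deriv f^[n] x‖ₑ ^ 2) x := by
  rcases h.exists_eventuallyEq_piece hu0 n z x with ⟨hx, h1⟩ | h1
  · rw [h1.fderiv_eq, indicator_of_mem hx, ← mul_pow]
    gcongr
    have hd := (h.differentiable.iterate n x).hasDerivAt.hasFDerivAt.restrictScalars ℝ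
    rw [fderiv_comp x ((hu.differentiable one_ne_zero) _) hd.differentiableAt, hd.fderiv,
      ← ofReal_norm, ← ofReal_norm, ← ofReal_norm, ← ENNReal.ofReal_mul (norm_nonneg _)]
    refine ENNReal.ofReal_le_ofReal ((ContinuousLinearMap.opNorm_comp_le _ _).trans ?_)
    refine mul_le_mul_of_nonneg_left ?_ (norm_nonneg _)
    simp
  · rw [h1.fderiv_eq, fderiv_fun_const, Pi.zero_apply, ← ofReal_norm, norm_zero]
    simp

theorem fderiv_indicator_piece_ne_zero (h : IsCubicPuzzle f U c e) {u : ℂ → ℝ}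
    (hu0 : ∀ x ∉ U, ∀ᶠ y in 𝓝 x, u y = 0) (hu1 : ∀ x ∈ f ⁻¹' U, u x = 1) {n : ℕ} {z x : ℂ}
    (hne : fderiv ℝ ((piece f U n z).indicator (u ∘ f^[n])) x ≠ 0) :
    f^[n] x ∈ U ∧ f^[n + 1] x ∉ U := by
  rcases h.exists_eventuallyEq_piece hu0 n z x with ⟨hx, h1⟩ | h1
  · refine ⟨piece_subset hx, fun hx' => hne ?_⟩
    have h2 : u ∘ f^[n] =ᶠ[𝓝 x] fun _ => 1 := by
      filter_upwards [(h.isOpen_preimage (n + 1)).mem_nhds hx'] with y hy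
      refine hu1 _ ?_
      rw [mem_preimage, ← iterate_succ_apply' f n y]
      exact hy
    rw [(h1.trans h2).fderiv_eq]
    simp
  · rw [h1.fderiv_eq] at hne
    simp at hne

/-- A connected set contained in all the pieces around a point is a single point, when the
critical point is aperiodic. -/
theorem subsingleton_of_subset_piece (h : IsCubicPuzzle f U c e)
    (hap : ∀ k, 0 < k → ∃ n, c ∉ piece f U n (f^[k] c)) {z : ℂ}
    (hz : ∀ n, f^[n] z ∈ U) {X : Set ℂ} (hX : IsPreconnected X)
    (hXz : ∀ n, X ⊆ piece f U n z) : X.Subsingleton := by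
  by_contra hns
  rw [not_subsingleton_iff] at hns
  obtain ⟨R, hR, hUR⟩ : ∃ R, 0 < R ∧ U ⊆ Metric.ball 0 R := by
    obtain ⟨R, hR⟩ := h.isBounded.subset_ball 0
    exact ⟨max R 1, by positivity, hR.trans (Metric.ball_subset_ball (le_max_left _ _))⟩
  obtain ⟨δ, hδ, henergy⟩ := exists_pos_le_lintegral_enorm_fderiv_sq hR hX hns
  obtain ⟨u, hu, hu0, hu1⟩ : ∃ u : ℂ → ℝ, ContDiff ℝ 1 u ∧ (∀ x ∉ U, ∀ᶠ y in 𝓝 x, u y = 0) ∧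
      ∀ x ∈ f ⁻¹' U, u x = 1 := by
    obtain ⟨u, h0, h1, -⟩ := exists_contMDiffMap_zero_one_nhds_of_isClosed (n := 1)
      (modelWithCornersSelf ℝ ℂ) h.isOpen.isClosed_compl
      (isClosed_closure (s := f ⁻¹' U))
      (disjoint_left.2 fun x hx hx' => hx (h.closure_subset hx'))
    refine ⟨u, u.contMDiff.contDiff, fun x hx => ?_, fun x hx => ?_⟩
    · exact (eventually_nhdsSet_iff_forall.1 h0) x hx
    · exact (eventually_nhdsSet_iff_forall.1 h1 x (subset_closure hx)).self_of_nhds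
  set φ : ℂ → ℝ≥0∞ := fun x => ‖fderiv ℝ u x‖ₑ ^ 2 with hφ
  have hucd : Continuous (fderiv ℝ u) := hu.continuous_fderiv one_ne_zero
  have hφm : Measurable φ := hucd.enorm.measurable.pow_const 2
  have hE : ∫⁻ x in U, φ x ≠ ∞ := by
    have h1 : ∫⁻ x in closure U, φ x < ∞ :=
      setLIntegral_lt_top_of_isCompact h.isBounded.isCompact_closure.measure_lt_top.ne
        h.isBounded.isCompact_closure (f := fun x => ‖fderiv ℝ u x‖₊ ^ 2) (by fun_prop)
    exact ((lintegral_mono_set subset_closure).trans_lt h1).ne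
  set k : ℕ → ℕ := diagonalDepth (fun n j => c ∈ piece f U n (f^[j] z)) with hk
  have hsum : ∑' n, (2⁻¹ : ℝ≥0∞) ^ k n = ∞ :=
    h.isCriticalTableau.tsum_eq_top_of_isTableauOver
      (fun m hm => hap m hm) (h.isTableauOver hz)
  set v : ℕ → ℂ → ℝ := fun n => (piece f U n z).indicator (u ∘ f^[n]) with hv
  have hvc : ∀ n, ContDiff ℝ 1 (v n) := fun n => h.contDiff_indicator_piece hu hu0 n z
  have hvE : ∀ n, ∫⁻ x, ‖fderiv ℝ (v n) x‖ₑ ^ 2 ≤ 2 ^ k n * ∫⁻ x in U, φ x := fun n =>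
    calc ∫⁻ x, ‖fderiv ℝ (v n) x‖ₑ ^ 2
        ≤ ∫⁻ x, (piece f U n z).indicator
            (fun x => φ (f^[n] x) * ‖deriv f^[n] x‖ₑ ^ 2) x :=
          lintegral_mono fun x => h.enorm_fderiv_indicator_piece_le hu hu0 n z x
      _ = ∫⁻ x in piece f U n z, φ (f^[n] x) * ‖deriv f^[n] x‖ₑ ^ 2 :=
          lintegral_indicator (h.isOpen_piece n z).measurableSet _
      _ ≤ 2 ^ k n * ∫⁻ x in U, φ x := h.lintegral_piece_le hφm n hz
  have hv1 : ∀ n, ∀ x ∈ X, v n x = 1 := fun n x hx => by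
    simp only [hv]
    rw [indicator_of_mem (hXz n hx)]
    refine hu1 _ ?_
    rw [mem_preimage, ← iterate_succ_apply' f n x]
    exact piece_subset (hXz (n + 1) hx)
  have hv0 : ∀ n x, R ≤ ‖x‖ → v n x = 0 := fun n x hx => by
    have : x ∉ piece f U n z := fun hxp => by
      have h1 : x ∈ U := h.preimage_antitone (Nat.zero_le n) (piece_subset hxp)
      have := hUR h1
      rw [mem_ball_zero_iff] at this
      exact hx.not_gt this
    simp only [hv]
    rw [indicator_of_notMem this]
  have hbound : ∀ M, δ * ∑ n ∈ Finset.range M, (2⁻¹ : ℝ≥0∞) ^ k n ≤ ∫⁻ x in U, φ x :=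
    fun M => mul_sum_le_of_energy_le henergy hvc (fun i j x hi hj => by
      have hi' := h.fderiv_indicator_piece_ne_zero hu0 hu1 hi
      have hj' := h.fderiv_indicator_piece_ne_zero hu0 hu1 hj
      by_contra hij
      rcases Nat.lt_or_gt_of_ne hij with hlt | hlt
      · exact hi'.2 (h.preimage_antitone hlt hj'.1)
      · exact hj'.2 (h.preimage_antitone hlt hi'.1)) hvE hv1 hv0 M
  have hlast : δ * ∑' n, (2⁻¹ : ℝ≥0∞) ^ k n ≤ ∫⁻ x in U, φ x := by
    rw [ENNReal.tsum_eq_iSup_nat, ENNReal.mul_iSup]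
    exact iSup_le hbound
  rw [hsum, ENNReal.mul_top hδ.ne'] at hlast
  exact hE (top_le_iff.1 hlast)

end IsCubicPuzzle

theorem exists_deriv_eq_zero_of_deriv_iterate_eq_zero {f : ℂ → ℂ} (hf : Differentiable ℂ f) {n : ℕ}
    {z : ℂ} (h : deriv f^[n] z = 0) : ∃ i < n, deriv f (f^[i] z) = 0 := by
  induction n generalizing z with
  | zero => simp at h
  | succ n ih =>
    rw [iterate_succ, deriv_comp z (hf.iterate n _) (hf z), mul_eq_zero] at h
    rcases h with h | h
    · obtain ⟨i, hi, hi'⟩ := ih h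
      exact ⟨i + 1, by omega, hi'⟩
    · exact ⟨0, by omega, h⟩

theorem IsOpenMap.iterate_map {X : Type*} [TopologicalSpace X] {f : X → X} (hf : IsOpenMap f) :
    ∀ n, IsOpenMap f^[n]
  | 0 => IsOpenMap.id
  | n + 1 => (IsOpenMap.iterate_map hf n).comp hf

theorem IsClosedMap.iterate_map {X : Type*} [TopologicalSpace X] {f : X → X} (hf : IsClosedMap f) :
    ∀ n, IsClosedMap f^[n]
  | 0 => IsClosedMap.id
  | n + 1 => (IsClosedMap.iterate_map hf n).comp hf

/-- The filled-in Julia set. -/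
def filledJulia (f : ℂ → ℂ) : Set ℂ := {z | Bornology.IsBounded (range fun n : ℕ => f^[n] z)}

/-- Outside the disc of radius `r`, the map `f` at least doubles the modulus. -/
def DoublesOutside (f : ℂ → ℂ) (r : ℝ) : Prop := 1 ≤ r ∧ ∀ z, r ≤ ‖z‖ → 2 * ‖z‖ ≤ ‖f z‖

namespace DoublesOutside

variable {f : ℂ → ℂ} {r : ℝ}

theorem mono (h : DoublesOutside f r) {R : ℝ} (hR : r ≤ R) : DoublesOutside f R :=
  ⟨h.1.trans hR, fun z hz => h.2 z (hR.trans hz)⟩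

theorem two_pow_mul_le (h : DoublesOutside f r)
    {z : ℂ} (hz : r ≤ ‖z‖) (n : ℕ) : 2 ^ n * ‖z‖ ≤ ‖f^[n] z‖ := by
  induction n with
  | zero => simp
  | succ n ih =>
    have h1 : ‖z‖ ≤ 2 ^ n * ‖z‖ := le_mul_of_one_le_left (norm_nonneg z) (one_le_pow₀ one_le_two)
    have := h.2 (f^[n] z) (hz.trans (h1.trans ih))
    rw [iterate_succ_apply', pow_succ]
    linarith

theorem norm_le_norm_iterate (h : DoublesOutside f r)
    {z : ℂ} (hz : r ≤ ‖z‖) (n : ℕ) : ‖z‖ ≤ ‖f^[n] z‖ :=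
  (le_mul_of_one_le_left (norm_nonneg z) (one_le_pow₀ one_le_two)).trans (h.two_pow_mul_le hz n)

theorem le_norm_iterate_of_le (h : DoublesOutside f r)
    {z : ℂ} {m n : ℕ} (hz : r ≤ ‖f^[m] z‖) (hmn : m ≤ n) :
    ‖f^[m] z‖ ≤ ‖f^[n] z‖ := by
  obtain ⟨k, rfl⟩ := Nat.exists_eq_add_of_le hmn
  rw [add_comm, iterate_add_apply]
  exact h.norm_le_norm_iterate hz k

theorem mem_filledJulia_iff (h : DoublesOutside f r)
    {z : ℂ} : z ∈ filledJulia f ↔ ∀ n, ‖f^[n] z‖ < r := by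
  constructor
  · intro hz n
    by_contra! hle
    have hz' : Bornology.IsBounded (range fun n : ℕ => f^[n] z) := hz
    obtain ⟨C, hC⟩ := hz'.exists_norm_le
    obtain ⟨k, hk⟩ := pow_unbounded_of_one_lt C (one_lt_two (α := ℝ))
    have h1 := h.two_pow_mul_le hle k
    rw [← iterate_add_apply] at h1
    have h2 : ‖f^[k + n] z‖ ≤ C := hC _ (mem_range_self (k + n))
    have h3 : (2 : ℝ) ^ k ≤ 2 ^ k * ‖f^[n] z‖ :=
      le_mul_of_one_le_right (by positivity) (h.1.trans hle)
    linarith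
  · intro hz
    show Bornology.IsBounded (range fun n : ℕ => f^[n] z)
    refine isBounded_iff_forall_norm_le.2 ⟨r, ?_⟩
    rintro _ ⟨n, rfl⟩
    exact (hz n).le

theorem mem_filledJulia_iff_iterate (h : DoublesOutside f r) (N : ℕ) {z : ℂ} :
    z ∈ filledJulia f ↔ ∀ n, f^[n] z ∈ {w | ‖f^[N] w‖ < r} := by
  rw [h.mem_filledJulia_iff]
  constructor
  · intro hz n
    show ‖f^[N] (f^[n] z)‖ < r
    rw [← iterate_add_apply]
    exact hz _
  · intro hz n
    by_contra! hle
    have h1 := h.norm_le_norm_iterate hle N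
    rw [← iterate_add_apply] at h1
    have h2 : ‖f^[N] (f^[n] z)‖ < r := hz n
    rw [← iterate_add_apply] at h2
    linarith

theorem tendsto_norm_iterate (h : DoublesOutside f r) (n : ℕ) :
    Tendsto (fun z => ‖f^[n] z‖) (cocompact ℂ) atTop := by
  refine tendsto_atTop_mono' _ ?_ (tendsto_norm_cocompact_atTop (E := ℂ))
  filter_upwards [(tendsto_norm_cocompact_atTop (E := ℂ)).eventually_ge_atTop r] with z hz
  exact h.norm_le_norm_iterate hz n

theorem isPuzzle (h : DoublesOutside f r)
    (hf : Differentiable ℂ f) (ho : IsOpenMap f) (hcl : IsClosedMap f) {N : ℕ}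
    (hd : ∀ z, r ≤ ‖f^[N] z‖ → deriv f^[N] z ≠ 0) :
    IsPuzzle f {z | ‖f^[N] z‖ < r} where
  differentiable := hf
  isOpenMap := ho
  isClosedMap := hcl
  isOpen := isOpen_lt (hf.iterate N).continuous.norm continuous_const
  isPreconnected := isPreconnected_norm_lt (hf.iterate N) (ho.iterate_map N) (hcl.iterate_map N)
    (h.tendsto_norm_iterate N) (one_pos.trans_le h.1) hd
  isBounded := by
    refine (Metric.isBounded_ball (x := (0 : ℂ)) (r := r)).subset fun z hz => ?_
    rw [mem_ball_zero_iff]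
    by_contra! hle
    have hz' : ‖f^[N] z‖ < r := hz
    linarith [h.norm_le_norm_iterate hle N]
  closure_subset := by
    have hcl : IsClosed {z | ‖f^[N] (f z)‖ ≤ r} :=
      isClosed_le ((hf.iterate N).continuous.comp hf.continuous).norm continuous_const
    have hsub : closure (f ⁻¹' {z | ‖f^[N] z‖ < r}) ⊆ {z | ‖f^[N] (f z)‖ ≤ r} :=
      closure_minimal (fun z hz => le_of_lt (show ‖f^[N] (f z)‖ < r from hz)) hcl
    intro z hz
    have h1 : ‖f^[N] (f z)‖ ≤ r := hsub hz
    show ‖f^[N] z‖ < r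
    by_contra! hle
    have h2 := h.2 _ hle
    rw [← iterate_succ_apply' f N z, iterate_succ_apply] at h2
    linarith [h.1]

end DoublesOutside

theorem exists_isCubicPuzzle {f : ℂ → ℂ} {a c₀ c₁ v₀ : ℂ} (ha : a ≠ 0)
    (hf : ∀ z, f z = a * (z - c₀) ^ 2 * (z - (3 * c₁ - c₀) / 2) + v₀) (hdf : Differentiable ℂ f)
    (ho : IsOpenMap f) (hcl : IsClosedMap f) {r : ℝ} (h : DoublesOutside f r)
    (hc₀ : c₀ ∈ filledJulia f) (hc₁ : c₁ ∉ filledJulia f) :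
    ∃ U e, IsCubicPuzzle f U c₀ e ∧ ∀ z, z ∈ filledJulia f ↔ ∀ n, f^[n] z ∈ U := by
  classical
  set r' := max r (‖c₁‖ + 1) with hr'
  have h' : DoublesOutside f r' := h.mono (le_max_left _ _)
  have hex : ∃ n, r' ≤ ‖f^[n] c₁‖ := by
    by_contra! hall
    exact hc₁ (h'.mem_filledJulia_iff.2 hall)
  obtain ⟨N, hN⟩ : ∃ N, Nat.find hex = N + 1 := by
    refine Nat.exists_eq_succ_of_ne_zero fun h0 => ?_
    have := Nat.find_spec hex
    rw [h0, iterate_zero, id] at this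
    have h2 := le_max_right r (‖c₁‖ + 1)
    linarith
  set R := ‖f^[N + 1] c₁‖ with hR
  have hrR : r' ≤ R := by
    have := Nat.find_spec hex
    rwa [hN] at this
  have hlt : ∀ j ≤ N, ‖f^[j] c₁‖ < R := fun j hj =>
    (not_le.1 (Nat.find_min hex (by omega : j < Nat.find hex))).trans_le hrR
  have hD : DoublesOutside f R := h'.mono hrR
  have hc₀R := hD.mem_filledJulia_iff.1 hc₀
  have hcrit : ∀ z, deriv f z = 0 → z = c₀ ∨ z = c₁ := by
    intro z hz
    rw [cubic_deriv hf] at hz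
    have h3 : (3 : ℂ) * a ≠ 0 := mul_ne_zero (by norm_num) ha
    rcases mul_eq_zero.1 hz with hz | hz
    · exact Or.inl (sub_eq_zero.1 ((mul_eq_zero.1 hz).resolve_left h3))
    · exact Or.inr (sub_eq_zero.1 hz)
  have hd : ∀ z, R ≤ ‖f^[N] z‖ → deriv f^[N] z ≠ 0 := by
    intro z hz hz'
    obtain ⟨i, hi, hi'⟩ := exists_deriv_eq_zero_of_deriv_iterate_eq_zero hdf hz'
    have e : f^[N] z = f^[N - i] (f^[i] z) := by
      rw [← iterate_add_apply, Nat.sub_add_cancel hi.le]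
    rcases hcrit _ hi' with h1 | h1
    · rw [e, h1] at hz
      linarith [hc₀R (N - i)]
    · rw [e, h1] at hz
      linarith [hlt (N - i) (by omega)]
  have hd' : deriv f^[N] (f c₁) ≠ 0 := by
    intro hz'
    obtain ⟨i, hi, hi'⟩ := exists_deriv_eq_zero_of_deriv_iterate_eq_zero hdf hz'
    rw [← iterate_succ_apply f i c₁] at hi'
    rcases hcrit _ hi' with h1 | h1
    · have e : f^[N + 1] c₁ = f^[N - i] (f^[i + 1] c₁) := by
        rw [← iterate_add_apply, show N - i + (i + 1) = N + 1 by omega]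
      have := hc₀R (N - i)
      rw [← h1, ← e] at this
      exact lt_irrefl _ this
    · have e : f^[(i + 1) * (N + 1)] c₁ = c₁ := by
        rw [iterate_mul]
        exact iterate_fixed h1 _
      have h2 := hD.le_norm_iterate_of_le (z := c₁) (m := N + 1) (n := (i + 1) * (N + 1)) le_rfl
        (Nat.le_mul_of_pos_left _ (Nat.succ_pos i))
      rw [e] at h2
      linarith [hlt 0 (Nat.zero_le N), show ‖f^[0] c₁‖ = ‖c₁‖ from rfl]
  refine ⟨_, _, isCubicPuzzle_of_cubic ha hf (hD.isPuzzle hdf ho hcl hd)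
    (one_pos.trans_le hD.1) rfl rfl hd' ?_, fun z => hD.mem_filledJulia_iff_iterate N⟩
  exact (hD.mem_filledJulia_iff_iterate N).1 hc₀

theorem isPreconnected_iInter_of_antitone {X : Type*} [TopologicalSpace X] [T4Space X]
    {C : ℕ → Set X} (hC : Antitone C) (hcpt : ∀ n, IsCompact (C n))
    (hpre : ∀ n, IsPreconnected (C n)) : IsPreconnected (⋂ n, C n) := by
  rw [isPreconnected_iff_subset_of_fully_disjoint_closed
    (isClosed_iInter fun n => (hcpt n).isClosed)]
  intro u v hu hv huv hd
  obtain ⟨U', V', hU', hV', huU, hvV, hd'⟩ := normal_separation hu hv hd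
  obtain ⟨n, hn⟩ : ∃ n, C n ⊆ U' ∪ V' := by
    refine exists_subset_nhds_of_isCompact (hC.directed_ge) hcpt fun x hx => ?_
    exact (hU'.union hV').mem_nhds (union_subset_union huU hvV (huv hx))
  rcases (hpre n).subset_or_subset hU' hV' hd' hn with h | h
  · refine Or.inl fun x hx => (huv hx).resolve_right fun hxv => ?_
    exact disjoint_left.1 hd' (h (mem_iInter.1 hx n)) (hvV hxv)
  · refine Or.inr fun x hx => (huv hx).resolve_left fun hxu => ?_
    exact disjoint_left.1 hd' (huU hxu) (h (mem_iInter.1 hx n))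

namespace IsPuzzle

variable {f : ℂ → ℂ} {U : Set ℂ}

theorem closure_piece_succ_subset (h : IsPuzzle f U) {n : ℕ} {z : ℂ} (hz : f^[n + 1] z ∈ U) :
    closure (piece f U (n + 1) z) ⊆ piece f U n z :=
  isPreconnected_connectedComponentIn.closure.subset_connectedComponentIn
    (subset_closure (mem_piece hz))
    ((closure_mono piece_subset).trans (h.closure_preimage_succ_subset n))

theorem isCompact_closure_piece (h : IsPuzzle f U)
    (n : ℕ) (z : ℂ) : IsCompact (closure (piece f U n z)) :=
  (h.isBounded.subset
    (piece_subset.trans (h.preimage_antitone (Nat.zero_le n)))).isCompact_closure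

theorem iInter_closure_piece (h : IsPuzzle f U) {z : ℂ} (hz : ∀ n, f^[n] z ∈ U) :
    ⋂ n, closure (piece f U n z) = ⋂ n, piece f U n z := by
  refine Subset.antisymm (subset_iInter fun n => ?_) (iInter_mono fun n => subset_closure)
  exact (iInter_subset _ (n + 1)).trans (h.closure_piece_succ_subset (hz (n + 1)))

theorem isPreconnected_iInter_piece (h : IsPuzzle f U) {z : ℂ} (hz : ∀ n, f^[n] z ∈ U) :
    IsPreconnected (⋂ n, piece f U n z) := by
  rw [← h.iInter_closure_piece hz]
  exact isPreconnected_iInter_of_antitone (fun m n hmn => closure_mono (h.piece_antitone z hmn))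
    (fun n => h.isCompact_closure_piece n z) fun n => isPreconnected_connectedComponentIn.closure

theorem connectedComponentIn_eq_iInter_piece (h : IsPuzzle f U)
    {K : Set ℂ} (hK : ∀ z, z ∈ K ↔ ∀ n, f^[n] z ∈ U)
    {z : ℂ} (hz : z ∈ K) : connectedComponentIn K z = ⋂ n, piece f U n z := by
  have hz' := (hK z).1 hz
  refine Subset.antisymm (subset_iInter fun n => ?_) ?_
  · exact connectedComponentIn_mono z fun x hx => (hK x).1 hx n
  · refine (h.isPreconnected_iInter_piece hz').subset_connectedComponentIn
      (mem_iInter.2 fun n => mem_piece (hz' n)) fun x hx => (hK x).2 fun n => ?_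
    exact piece_subset (mem_iInter.1 hx n)

theorem isCompact_of_mem_iff (h : IsPuzzle f U)
    {K : Set ℂ} (hK : ∀ z, z ∈ K ↔ ∀ n, f^[n] z ∈ U) : IsCompact K := by
  have e : K = ⋂ n, closure (f^[n] ⁻¹' U) := by
    ext z
    rw [hK, mem_iInter]
    exact ⟨fun hz n => subset_closure (hz n), fun hz n =>
      h.closure_preimage_succ_subset n (hz (n + 1))⟩
  have hcl : IsClosed K := by
    rw [e]
    exact isClosed_iInter fun n => isClosed_closure
  exact h.isBounded.isCompact_closure.of_isClosed_subset hcl fun z hz =>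
    subset_closure ((hK z).1 hz 0)

end IsPuzzle

theorem IsCubicPuzzle.cantor {f : ℂ → ℂ} {U K : Set ℂ} {c e : ℂ} (h : IsCubicPuzzle f U c e)
    (hK : ∀ z, z ∈ K ↔ ∀ n, f^[n] z ∈ U)
    (hap : ∀ n, 1 ≤ n → f^[n] '' connectedComponentIn K c ≠ connectedComponentIn K c) :
    (frontier K).Nonempty ∧ IsCompact (frontier K) ∧ Perfect (frontier K) ∧
      IsTotallyDisconnected (frontier K) := by
  have hcK : c ∈ K := (hK c).2 h.mem_U
  have hap' : ∀ k, 0 < k → ∃ n, c ∉ piece f U n (f^[k] c) := by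
    intro k hk
    by_contra! hall
    refine hap k hk ?_
    rw [h.connectedComponentIn_eq_iInter_piece hK hcK]
    exact h.image_iInter_piece hall
  have hsub : ∀ z ∈ K, (⋂ n, piece f U n z).Subsingleton := fun z hz =>
    h.subsingleton_of_subset_piece hap' ((hK z).1 hz)
      (h.isPreconnected_iInter_piece ((hK z).1 hz)) fun n => iInter_subset _ n
  have hcpt : IsCompact K := h.isCompact_of_mem_iff hK
  have htd : IsTotallyDisconnected K := by
    intro t ht htp x hx y hy
    have h1 := htp.subset_connectedComponentIn hx ht
    rw [h.connectedComponentIn_eq_iInter_piece hK (ht hx)] at h1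
    exact hsub x (ht hx) (h1 hx) (h1 hy)
  have h_int : interior K = ∅ := by
    by_contra hne
    obtain ⟨x, hx⟩ := nonempty_iff_ne_empty.2 hne
    obtain ⟨ε, hε, hball⟩ := Metric.isOpen_iff.1 isOpen_interior x hx
    have h1 := htd _ (hball.trans interior_subset) (convex_ball x ε).isPreconnected
    have h2 : x + (ε / 2 : ℝ) ∈ Metric.ball x ε := by
      rw [mem_ball_iff_norm, add_sub_cancel_left, Complex.norm_real, Real.norm_eq_abs,
        abs_of_pos (by positivity)]
      linarith
    have h3 := h1 h2 (Metric.mem_ball_self hε)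
    rw [add_eq_left, Complex.ofReal_eq_zero] at h3
    linarith
  have hfr : frontier K = K := by
    rw [frontier, hcpt.isClosed.closure_eq, h_int, sdiff_empty]
  rw [hfr]
  refine ⟨⟨c, hcK⟩, hcpt, ⟨hcpt.isClosed, fun x hx => ?_⟩, htd⟩
  have hxU := (hK x).1 hx
  have heU : ∀ n, f^[n] e ∈ U
    | 0 => h.e_mem
    | n + 1 => by
      rw [iterate_succ_apply, h.apply_e, ← iterate_succ_apply]
      exact h.mem_U _
  have hce : c ≠ e := fun he => h.e_notMem (he ▸ mem_piece (h.mem_U 1))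
  rw [accPt_iff_nhds]
  intro W hW
  obtain ⟨n, hn⟩ : ∃ n, closure (piece f U n x) ⊆ W := by
    refine exists_subset_nhds_of_isCompact (V := fun n => closure (piece f U n x))
      (Antitone.directed_ge fun m n hmn => closure_mono (h.piece_antitone x hmn))
      (fun n => h.isCompact_closure_piece n x) fun y hy => ?_
    rw [h.iInter_closure_piece hxU] at hy
    rwa [hsub x hx hy (mem_iInter.2 fun n => mem_piece (hxU n))]
  have hpre : ∀ w, (∀ n, f^[n] w ∈ U) → ∃ y ∈ W ∩ K, f^[n] y = w := by
    intro w hw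
    have : w ∈ f^[n] '' piece f U n x := by
      rw [h.image_iterate_piece_self (hxU n)]
      exact hw 0
    obtain ⟨y, hy, rfl⟩ := this
    refine ⟨y, ⟨hn (subset_closure hy), (hK y).2 fun m => ?_⟩, rfl⟩
    rcases le_total m n with hmn | hmn
    · exact h.preimage_antitone hmn (piece_subset hy)
    · obtain ⟨k, rfl⟩ := Nat.exists_eq_add_of_le hmn
      rw [add_comm, iterate_add_apply]
      exact hw k
  obtain ⟨y, hy, hyc⟩ := hpre c h.mem_U
  obtain ⟨y', hy', hye⟩ := hpre e heU
  by_cases hyx : y = x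
  · refine ⟨y', hy', fun hy'x => hce ?_⟩
    rw [← hyc, ← hye, hyx, hy'x]
  · exact ⟨y, hy, hyx⟩

/-- If no critical point escapes, the filled-in Julia set is connected. -/
theorem DoublesOutside.isPreconnected_filledJulia {f : ℂ → ℂ} {r : ℝ} (h : DoublesOutside f r)
    (hdf : Differentiable ℂ f) (ho : IsOpenMap f) (hcl : IsClosedMap f)
    (hcrit : ∀ z, deriv f z = 0 → z ∈ filledJulia f) : IsPreconnected (filledJulia f) := by
  have hd : ∀ n z, r ≤ ‖f^[n] z‖ → deriv f^[n] z ≠ 0 := by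
    intro n z hz hz'
    obtain ⟨i, hi, hi'⟩ := exists_deriv_eq_zero_of_deriv_iterate_eq_zero hdf hz'
    have := h.mem_filledJulia_iff.1 (hcrit _ hi') (n - i)
    rw [← iterate_add_apply, Nat.sub_add_cancel hi.le] at this
    linarith
  have hp : IsPuzzle f {z | ‖f^[0] z‖ < r} := h.isPuzzle hdf ho hcl (hd 0)
  have hpre : ∀ n, IsPreconnected (f^[n] ⁻¹' {z | ‖f^[0] z‖ < r}) := fun n =>
    isPreconnected_norm_lt (hdf.iterate n) (ho.iterate_map n) (hcl.iterate_map n)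
      (h.tendsto_norm_iterate n) (one_pos.trans_le h.1) (hd n)
  have e : filledJulia f = ⋂ n, closure (f^[n] ⁻¹' {z | ‖f^[0] z‖ < r}) := by
    ext z
    rw [h.mem_filledJulia_iff_iterate 0, mem_iInter]
    exact ⟨fun hz n => subset_closure (hz n), fun hz n =>
      hp.closure_preimage_succ_subset n (hz (n + 1))⟩
  rw [e]
  refine isPreconnected_iInter_of_antitone (fun m n hmn => closure_mono (hp.preimage_antitone hmn))
    (fun n => ?_) fun n => (hpre n).closure
  exact (hp.isBounded.subset (hp.preimage_antitone (Nat.zero_le n))).isCompact_closure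

theorem image_filledJulia {f : ℂ → ℂ} (hs : Surjective f) : f '' filledJulia f = filledJulia f := by
  have hiff : ∀ z, f z ∈ filledJulia f ↔ z ∈ filledJulia f := by
    intro z
    have e : (range fun n : ℕ => f^[n] z) = {z} ∪ range fun n : ℕ => f^[n] (f z) := by
      ext w
      constructor
      · rintro ⟨n, rfl⟩
        cases n with
        | zero => exact Or.inl rfl
        | succ n => exact Or.inr ⟨n, rfl⟩
      · rintro (rfl | ⟨n, rfl⟩)
        · exact ⟨0, rfl⟩
        · exact ⟨n + 1, rfl⟩
    show Bornology.IsBounded (range fun n : ℕ => f^[n] (f z)) ↔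
      Bornology.IsBounded (range fun n : ℕ => f^[n] z)
    rw [e, Bornology.isBounded_union]
    simp [Bornology.isBounded_singleton]
  ext w
  constructor
  · rintro ⟨z, hz, rfl⟩
    exact (hiff z).2 hz
  · intro hw
    obtain ⟨z, rfl⟩ := hs w
    exact ⟨z, (hiff z).1 hw, rfl⟩

theorem exists_continuous_exp_eq {X : Type*} [TopologicalSpace X] [CompactSpace X] [T2Space X]
    [TotallyDisconnectedSpace X] {g : X → ℂ} (hg : Continuous g) (h0 : ∀ x, g x ≠ 0) :
    ∃ H : X → ℂ, Continuous H ∧ ∀ x, Complex.exp (H x) = g x := by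
  classical
  suffices h : ∃ C : Set X, IsClopen C ∧ univ ⊆ C ∧ ∃ H : X → ℂ, Continuous H ∧
      ∀ x ∈ C, Complex.exp (H x) = g x by
    obtain ⟨C, -, hC, H, hH, hHg⟩ := h
    exact ⟨H, hH, fun x => hHg x (hC trivial)⟩
  refine isCompact_univ.induction_on (p := fun s : Set X => ∃ C : Set X, IsClopen C ∧ s ⊆ C ∧
    ∃ H : X → ℂ, Continuous H ∧ ∀ x ∈ C, Complex.exp (H x) = g x) ?_ ?_ ?_ ?_
  · exact ⟨∅, isClopen_empty, Subset.rfl, 0, continuous_const, by simp⟩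
  · rintro s t hst ⟨C, hC, htC, H⟩
    exact ⟨C, hC, hst.trans htC, H⟩
  · rintro s t ⟨C, hC, hsC, H, hH, hHg⟩ ⟨C', hC', htC', H', hH', hHg'⟩
    refine ⟨C ∪ C', hC.union hC', union_subset_union hsC htC', C.piecewise H H',
      hH.piecewise (by simp [hC.frontier_eq]) hH', fun x hx => ?_⟩
    by_cases hxC : x ∈ C
    · simpa [hxC] using hHg x hxC
    · simpa [hxC] using hHg' x (hx.resolve_left hxC)
  · intro x _
    have ho : IsOpen ((fun y => g y / g x) ⁻¹' Complex.slitPlane) :=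
      Complex.isOpen_slitPlane.preimage (hg.div_const _)
    obtain ⟨C, hC, hxC, hCs⟩ := compact_exists_isClopen_in_isOpen ho
      (show x ∈ _ by simp [h0 x])
    refine ⟨C, mem_nhdsWithin_of_mem_nhds (hC.isOpen.mem_nhds hxC), C, hC, Subset.rfl,
      fun y => Complex.log (C.piecewise (fun y => g y / g x) 1 y) + Complex.log (g x), ?_, ?_⟩
    · refine Continuous.add (Continuous.clog ((hg.div_const _).piecewise
        (by simp [hC.frontier_eq]) continuous_const) fun y => ?_) continuous_const
      by_cases hy : y ∈ C
      · simpa [hy] using hCs hy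
      · simp [hy]
    · intro y hy
      rw [Complex.exp_add, Complex.exp_log (by simp [hy, h0]), Complex.exp_log (h0 x)]
      simp [hy, h0 x]

theorem Complex.exists_continuous_exp_eq {g : ℂ → ℂ} (hg : Continuous g) (h0 : ∀ z, g z ≠ 0) :
    ∃ L : ℂ → ℂ, Continuous L ∧ ∀ z, Complex.exp (L z) = g z := by
  rcases isCoveringMapOn_exp.existsUnique_continuousMap_lifts ⟨g, hg⟩
    (exp_log (h0 0)) (fun x => h0 x) with ⟨L, ⟨-, hL⟩, -⟩
  exact ⟨L, L.continuous, fun z => congrFun hL z⟩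

theorem IsCompact.interior_eq_empty_of_isTotallyDisconnected_frontier {K : Set ℂ}
    (hK : IsCompact K) (hJ : IsTotallyDisconnected (frontier K)) : interior K = ∅ := by
  classical
  by_contra hne
  obtain ⟨p, hp⟩ := nonempty_iff_ne_empty.2 hne
  have hJc : IsCompact (frontier K) :=
    hK.of_isClosed_subset isClosed_frontier hK.isClosed.frontier_subset
  have := isCompact_iff_compactSpace.1 hJc
  have : TotallyDisconnectedSpace (frontier K) :=
    totallyDisconnectedSpace_subtype_iff.2 hJ
  obtain ⟨H, hH, hHp⟩ := _root_.exists_continuous_exp_eq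
    (g := fun z : frontier K => (z : ℂ) - p) (by fun_prop)
    (fun z h => z.2.2 (by rwa [sub_eq_zero.1 h]))
  obtain ⟨G, hG⟩ := ContinuousMap.exists_restrict_eq isClosed_frontier ⟨H, hH⟩
  have hGH : ∀ z ∈ frontier K, Complex.exp (G z) = z - p := fun z hz => by
    rw [← hHp ⟨z, hz⟩]
    exact congrArg Complex.exp (DFunLike.congr_fun hG ⟨z, hz⟩)
  obtain ⟨L, hL, hLF⟩ := Complex.exists_continuous_exp_eq
    (g := K.piecewise (fun z => Complex.exp (G z)) (fun z => z - p))
    (Continuous.piecewise hGH (by fun_prop) (by fun_prop)) (fun z => by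
      by_cases hz : z ∈ K
      · simp [hz]
      · simpa [hz, sub_eq_zero] using fun h : z = p => hz (h ▸ interior_subset hp))
  obtain ⟨r, hr⟩ := hK.isBounded.subset_ball p
  set ρ : ℝ := max r 1
  have hρ : 0 < ρ := lt_max_of_lt_right one_pos
  have hexp : ∀ θ : ℝ, Complex.exp (L (p + ρ * Complex.exp (θ * Complex.I)) - θ * Complex.I)
      = ρ := fun θ => by
    have hz : p + ρ * Complex.exp (θ * Complex.I) ∉ K := fun h => by
      have := hr h
      rw [mem_ball_iff_norm, add_sub_cancel_left, norm_mul, Complex.norm_exp_ofReal_mul_I,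
        mul_one, Complex.norm_real, Real.norm_of_nonneg hρ.le] at this
      exact (le_max_left r 1).not_gt this
    rw [Complex.exp_sub, hLF, piecewise_eq_of_notMem _ _ _ hz, add_sub_cancel_left,
      mul_div_assoc, div_self (Complex.exp_ne_zero _), mul_one]
  have key := Complex.isCoveringMap_exp.const_of_comp
    (g := fun θ : ℝ => L (p + ρ * Complex.exp (θ * Complex.I)) - θ * Complex.I)
    (by fun_prop) (fun a b => Subtype.ext ((hexp a).trans (hexp b).symm)) 0 (2 * Real.pi)
  simp only [Complex.ofReal_zero, zero_mul, Complex.exp_zero, Complex.ofReal_mul,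
    Complex.ofReal_ofNat, Complex.exp_two_pi_mul_I, sub_zero] at key
  exact Complex.two_pi_I_ne_zero (sub_eq_self.1 key.symm)

theorem filledJulia_mem_nhds_of_superattracting {f : ℂ → ℂ} {r : ℝ} {c : ℂ}
    (h : DoublesOutside f r) (hdf : Differentiable ℂ f) (hc : deriv f c = 0) {n : ℕ} (hn : 1 ≤ n)
    (hper : f^[n] c = c) : filledJulia f ∈ 𝓝 c := by
  have hd : HasDerivAt f^[n] 0 c := by
    obtain ⟨m, rfl⟩ := Nat.exists_eq_add_of_le' hn
    have h1 : HasDerivAt f 0 c := hc ▸ (hdf c).hasDerivAt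
    have h2 := ((hdf.iterate m) (f c)).hasDerivAt
    simpa [iterate_succ] using h2.comp c h1
  have hev : ∀ᶠ z in 𝓝 c, ‖f^[n] z - c‖ ≤ 1 / 2 * ‖z - c‖ := by
    have := hd.isLittleO.def (c := 1 / 2) (by norm_num)
    simpa [hper] using this
  obtain ⟨δ, hδ, hb⟩ := Metric.eventually_nhds_iff_ball.1 hev
  refine mem_of_superset (Metric.ball_mem_nhds c hδ) fun z hz => ?_
  by_contra hzK
  have hk : ∀ k, (f^[n])^[k] z ∈ Metric.ball c δ := fun k => by
    induction k with
    | zero => exact hz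
    | succ k ih =>
      rw [iterate_succ_apply', mem_ball_iff_norm]
      rw [mem_ball_iff_norm] at ih
      have := hb _ (mem_ball_iff_norm.2 ih)
      linarith [norm_nonneg ((f^[n])^[k] z - c)]
  have h' := h.mono (le_max_left r (‖c‖ + δ))
  rw [h'.mem_filledJulia_iff] at hzK
  push Not at hzK
  obtain ⟨m, hm⟩ := hzK
  have h1 := h'.le_norm_iterate_of_le hm (Nat.le_mul_of_pos_left m hn)
  rw [iterate_mul] at h1
  have h2 := mem_ball_iff_norm.1 (hk m)
  have h3 := norm_sub_norm_le ((f^[n])^[m] z) c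
  linarith [le_max_right r (‖c‖ + δ)]

theorem DoublesOutside.isCompact_filledJulia {f : ℂ → ℂ} {r : ℝ} (h : DoublesOutside f r)
    (hf : Continuous f) : IsCompact (filledJulia f) := by
  have e : filledJulia f = ⋂ n, {z | ‖f^[n] z‖ ≤ r} := by
    ext z
    rw [h.mem_filledJulia_iff, mem_iInter]
    refine ⟨fun hz n => (hz n).le, fun hz n => (hz n).lt_of_ne fun hn => ?_⟩
    have h1 := h.2 _ hn.ge
    have h2 : ‖f^[n + 1] z‖ ≤ r := hz (n + 1)
    rw [iterate_succ_apply'] at h2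
    linarith [h.1]
  refine (isCompact_closedBall (0 : ℂ) r).of_isClosed_subset ?_ fun z hz => ?_
  · rw [e]
    exact isClosed_iInter fun n => isClosed_le (hf.iterate n).norm continuous_const
  · exact mem_closedBall_zero_iff.2 (h.mem_filledJulia_iff.1 hz 0).le

theorem image_iterate_connectedComponentIn_ne {f : ℂ → ℂ} {r : ℝ} {c : ℂ}
    (h : DoublesOutside f r) (hdf : Differentiable ℂ f) (hc : deriv f c = 0)
    (hcK : c ∈ filledJulia f) (hJ : IsTotallyDisconnected (frontier (filledJulia f))) {n : ℕ}
    (hn : 1 ≤ n) : f^[n] '' connectedComponentIn (filledJulia f) c ≠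
      connectedComponentIn (filledJulia f) c := by
  intro hper
  have hK := h.isCompact_filledJulia hdf.continuous
  have h_int := hK.interior_eq_empty_of_isTotallyDisconnected_frontier hJ
  have hfr : frontier (filledJulia f) = filledJulia f := by
    rw [hK.isClosed.frontier_eq, h_int, sdiff_empty]
  have hsing : connectedComponentIn (filledJulia f) c = {c} :=
    (hJ _ (by rw [hfr]; exact connectedComponentIn_subset _ _)
      isPreconnected_connectedComponentIn).eq_singleton_of_mem (mem_connectedComponentIn hcK)
  rw [hsing, image_singleton, singleton_eq_singleton_iff] at hper
  have := mem_interior_iff_mem_nhds.2 (filledJulia_mem_nhds_of_superattracting h hdf hc hn hper)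
  simp [h_int] at this

theorem Polynomial.exists_doublesOutside {p : Polynomial ℂ} (hp : 2 ≤ p.natDegree) :
    ∃ r, DoublesOutside (fun w => p.eval w) r := by
  have h1 : 0 < p.divX.degree := by
    rw [← natDegree_pos_iff_degree_pos, natDegree_divX_eq_natDegree_tsub_one]
    omega
  have h2 := p.divX.tendsto_norm_atTop h1 (tendsto_norm_cocompact_atTop (E := ℂ))
  have h3 := (h2.eventually_ge_atTop (2 + ‖p.coeff 0‖)).and
    ((tendsto_norm_cocompact_atTop (E := ℂ)).eventually_ge_atTop 1)
  obtain ⟨s, hs⟩ := (Metric.hasBasis_cobounded_compl_closedBall (0 : ℂ)).eventually_iff.1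
    (Metric.cobounded_eq_cocompact (α := ℂ) ▸ h3) |>.imp fun _ h => h.2
  refine ⟨max 1 (s + 1), le_max_left _ _, fun z hz => ?_⟩
  obtain ⟨h4, h5⟩ := hs (x := z) (by
    simp only [mem_compl_iff, mem_closedBall_zero_iff, not_le]
    linarith [le_max_right 1 (s + 1)])
  have h6 : p.eval z = p.divX.eval z * z + p.coeff 0 := by
    conv_lhs => rw [← p.divX_mul_X_add]
    simp
  have h7 := norm_sub_le_norm_add (p.divX.eval z * z) (p.coeff 0)
  rw [norm_mul] at h7
  change 2 * ‖z‖ ≤ ‖p.eval z‖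
  rw [h6]
  nlinarith [norm_nonneg (p.coeff 0)]

theorem Polynomial.exists_cubic_form {p : Polynomial ℂ} (hp : p.natDegree = 3) {c₀ : ℂ}
    (hc₀ : p.derivative.eval c₀ = 0) : ∃ a c₁ v₀ : ℂ, a ≠ 0 ∧
      ∀ z, p.eval z = a * (z - c₀) ^ 2 * (z - (3 * c₁ - c₀) / 2) + v₀ := by
  have ha : p.coeff 3 ≠ 0 := by
    rw [← hp]
    exact leadingCoeff_ne_zero.2 fun h => by simp [h] at hp
  have he : ∀ z, p.eval z = p.coeff 0 + p.coeff 1 * z + p.coeff 2 * z ^ 2 + p.coeff 3 * z ^ 3 :=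
    fun z => by
      rw [eval_eq_sum_range, hp]
      simp [Finset.sum_range_succ]
  have hd : p.coeff 1 + 2 * p.coeff 2 * c₀ + 3 * p.coeff 3 * c₀ ^ 2 = 0 := by
    rw [← hc₀, eval_eq_sum_range' (n := 3) (by have := natDegree_derivative_le p; omega)]
    simp [Finset.sum_range_succ, coeff_derivative]
    ring
  refine ⟨p.coeff 3, -(2 * p.coeff 2) / (3 * p.coeff 3) - c₀, p.eval c₀, ha, fun z => ?_⟩
  have hb : p.coeff 1 = -(2 * p.coeff 2 * c₀ + 3 * p.coeff 3 * c₀ ^ 2) := by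
    linear_combination hd
  rw [he z, he c₀, hb]
  field_simp
  ring

end

/-- **Branner–Hubbard.** For a cubic polynomial with exactly one critical point `c₀` in
the filled-in Julia set (all other critical points escaping), the Julia set is a Cantor
set if and only if the component of the filled-in Julia set containing `c₀` is
aperiodic. -/
theorem branner_hubbard_cubic
    (f : Polynomial ℂ) (hdeg : f.natDegree = 3)
    (Kf : Set ℂ)
    (hKf : Kf = {z : ℂ | Bornology.IsBounded
      (Set.range fun n : ℕ => (fun w : ℂ => f.eval w)^[n] z)})
    (Jf : Set ℂ) (hJf : Jf = frontier Kf)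
    (c₀ : ℂ) (hc₀ : f.derivative.eval c₀ = 0) (hc₀K : c₀ ∈ Kf)
    (hother : ∀ c : ℂ, f.derivative.eval c = 0 → c ≠ c₀ → c ∉ Kf) :
    (Jf.Nonempty ∧ IsCompact Jf ∧ Perfect Jf ∧ IsTotallyDisconnected Jf) ↔
      (∀ n : ℕ, 1 ≤ n →
        (fun w : ℂ => f.eval w)^[n] '' connectedComponentIn Kf c₀ ≠
          connectedComponentIn Kf c₀) := by
  have hKJ : Kf = filledJulia fun w => f.eval w := hKf
  subst hJf
  clear hKf
  subst hKJ
  obtain ⟨r, hr⟩ := f.exists_doublesOutside (by omega)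
  have hdf : Differentiable ℂ fun w => f.eval w := f.differentiable
  have hd : ∀ z, deriv (fun w => f.eval w) z = f.derivative.eval z := fun z => f.deriv
  have hq := Polynomial.isOpenQuotientMap_eval f (by omega)
  have hcl : IsClosedMap fun w => f.eval w := Polynomial.isClosedMap_eval f
  refine ⟨fun h n hn => image_iterate_connectedComponentIn_ne hr hdf ((hd c₀).trans hc₀) hc₀K
    h.2.2.2 hn, fun hap => ?_⟩
  obtain ⟨a, c₁, v₀, ha, hf⟩ := f.exists_cubic_form hdeg hc₀
  have hcub := cubic_deriv hf
  by_cases hc₁ : c₁ ∈ filledJulia fun w => f.eval w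
  · refine absurd ?_ (hap 1 le_rfl)
    have hpre := hr.isPreconnected_filledJulia hdf hq.isOpenMap hcl fun z hz => by
      rw [hcub, mul_eq_zero, mul_eq_zero, sub_eq_zero, sub_eq_zero] at hz
      rcases hz with (hz | rfl) | rfl
      · simp [ha] at hz
      · exact hc₀K
      · exact hc₁
    rw [hpre.connectedComponentIn hc₀K, Function.iterate_one, image_filledJulia hq.surjective]
  · obtain ⟨U, e, hU, hK⟩ := exists_isCubicPuzzle ha hf hdf hq.isOpenMap hcl hr hc₀K hc₁
    exact hU.cantor hK hap
end

section
/- Let f be a complex polynomial of degree d ≥ 2. For every x ∈ K_f, the image under f of the connected component of K_f containing x equals the connected component of K_f containing f(x); that is, f(K_f(x)) = K_f(f(x)). -/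
/-- A continuous open map sends each connected component of a compact full preimage onto a
connected component of the target set. -/
theorem IsOpenMap.image_connectedComponentIn_preimage {X Y : Type*} [TopologicalSpace X]
    [TopologicalSpace Y] [T2Space X] [T2Space Y] {f : X → Y} (hfo : IsOpenMap f)
    (hfc : Continuous f) {s : Set Y} (hs : IsCompact (f ⁻¹' s)) {x : X} (hx : f x ∈ s) :
    f '' connectedComponentIn (f ⁻¹' s) x = connectedComponentIn s (f x) := by
  refine Set.Subset.antisymm ?_ ?_
  · exact (isPreconnected_connectedComponentIn.image _ hfc.continuousOn).subset_connectedComponentIn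
      (Set.mem_image_of_mem _ (mem_connectedComponentIn hx))
      ((Set.image_mono (connectedComponentIn_subset _ _)).trans (Set.image_preimage_subset _ _))
  have : CompactSpace (f ⁻¹' s) := isCompact_iff_compactSpace.1 hs
  let g : f ⁻¹' s → s := s.restrictPreimage f
  have hgo : IsOpenMap g := hfo.restrictPreimage s
  have hgc : Continuous g := hfc.restrictPreimage
  let a : f ⁻¹' s := ⟨x, hx⟩
  rw [connectedComponentIn_eq_image hx, connectedComponentIn_eq_image (F := f ⁻¹' s) hx]
  rintro _ ⟨y, hy, rfl⟩
  have hne : (⋂ U : {U : Set (f ⁻¹' s) // IsClopen U ∧ a ∈ U}, U.1 ∩ g ⁻¹' {y}).Nonempty := by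
    have : Nonempty {U : Set (f ⁻¹' s) // IsClopen U ∧ a ∈ U} :=
      ⟨⟨Set.univ, isClopen_univ, Set.mem_univ _⟩⟩
    have hcl : ∀ U : {U : Set (f ⁻¹' s) // IsClopen U ∧ a ∈ U}, IsClosed (U.1 ∩ g ⁻¹' {y}) :=
      fun U => U.2.1.1.inter (isClosed_singleton.preimage hgc)
    refine IsCompact.nonempty_iInter_of_directed_nonempty_isCompact_isClosed _ ?_ ?_
      (fun U => (hcl U).isCompact) hcl
    · intro U V
      exact ⟨⟨U.1 ∩ V.1, U.2.1.inter V.2.1, U.2.2, V.2.2⟩,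
        Set.inter_subset_inter_left _ Set.inter_subset_left,
        Set.inter_subset_inter_left _ Set.inter_subset_right⟩
    · intro U
      have hU : IsClopen (g '' U.1) :=
        ⟨(U.2.1.1.isCompact.image hgc).isClosed, hgo _ U.2.1.2⟩
      obtain ⟨z, hz, hzy⟩ := hU.connectedComponent_subset (Set.mem_image_of_mem g U.2.2) hy
      exact ⟨z, hz, hzy⟩
  obtain ⟨z, hz⟩ := hne
  rw [Set.mem_iInter] at hz
  refine ⟨z, ⟨z, ?_, rfl⟩, congrArg Subtype.val (hz ⟨Set.univ, isClopen_univ, Set.mem_univ _⟩).2⟩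
  rw [connectedComponent_eq_iInter_isClopen, Set.mem_iInter]
  exact fun U => (hz U).1

namespace Polynomial

theorem exists_forall_two_mul_norm_le_norm_eval {f : ℂ[X]} (hf : 2 ≤ f.natDegree) :
    ∃ R : ℝ, 1 ≤ R ∧ ∀ z : ℂ, R ≤ ‖z‖ → 2 * ‖z‖ ≤ ‖f.eval z‖ := by
  have hdeg : 0 < f.divX.degree := by
    rw [← natDegree_pos_iff_degree_pos, natDegree_divX_eq_natDegree_tsub_one]
    omega
  have ht := f.divX.tendsto_norm_atTop hdeg (tendsto_norm_cobounded_atTop (E := ℂ))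
  have hev := ht.eventually_ge_atTop 3
  rw [← comap_norm_atTop, (Filter.atTop_basis.comap _).eventually_iff] at hev
  obtain ⟨r, -, hr⟩ := hev
  refine ⟨max 1 (max r ‖f.coeff 0‖), le_max_left _ _, fun z hz => ?_⟩
  simp only [max_le_iff] at hz
  have h3 : 3 ≤ ‖f.divX.eval z‖ := hr hz.2.1
  have heq : f.eval z = f.divX.eval z * z + f.coeff 0 := by
    conv_lhs => rw [← f.divX_mul_X_add]
    simp
  have htri := norm_sub_norm_le (f.divX.eval z * z) (-f.coeff 0)
  rw [sub_neg_eq_add, ← heq, norm_mul, norm_neg] at htri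
  nlinarith [norm_nonneg z]

theorem isCompact_setOf_isBounded_range_iterate_eval {f : ℂ[X]} (hf : 2 ≤ f.natDegree) :
    IsCompact {z : ℂ | Bornology.IsBounded
      (Set.range fun n : ℕ => (fun w : ℂ => f.eval w)^[n] z)} := by
  obtain ⟨R, hR, hgrow⟩ := exists_forall_two_mul_norm_le_norm_eval hf
  have hesc : ∀ z : ℂ, R < ‖z‖ → ∀ n : ℕ,
      2 ^ n * ‖z‖ ≤ ‖(fun w : ℂ => f.eval w)^[n] z‖ := by
    intro z hz n
    induction n with
    | zero => simp
    | succ n ih =>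
      rw [Function.iterate_succ_apply']
      have h1 : (1 : ℝ) ≤ 2 ^ n := one_le_pow₀ one_le_two
      have h2 : R ≤ ‖(fun w : ℂ => f.eval w)^[n] z‖ := by nlinarith
      calc 2 ^ (n + 1) * ‖z‖ = 2 * (2 ^ n * ‖z‖) := by ring
        _ ≤ 2 * ‖(fun w : ℂ => f.eval w)^[n] z‖ := by gcongr
        _ ≤ _ := hgrow _ h2
  have heq : {z : ℂ | Bornology.IsBounded
      (Set.range fun n : ℕ => (fun w : ℂ => f.eval w)^[n] z)} =
      ⋂ n : ℕ, (fun w : ℂ => f.eval w)^[n] ⁻¹' Metric.closedBall 0 R := by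
    ext z
    simp only [Set.mem_ofPred_eq, Set.mem_iInter, Set.mem_preimage, mem_closedBall_zero_iff]
    constructor
    · intro hb n
      by_contra! hn
      obtain ⟨M, hM⟩ := hb.exists_norm_le
      obtain ⟨k, hk⟩ := pow_unbounded_of_one_lt M (one_lt_two (α := ℝ))
      have h1 := hesc _ hn k
      rw [← Function.iterate_add_apply] at h1
      have h2 := hM _ (Set.mem_range_self (k + n))
      have h3 : (0 : ℝ) < 2 ^ k := by positivity
      nlinarith
    · intro h
      exact isBounded_iff_forall_norm_le.2 ⟨R, Set.forall_mem_range.2 h⟩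
  rw [heq]
  refine (isCompact_closedBall (0 : ℂ) R).of_isClosed_subset
    (isClosed_iInter fun n => Metric.isClosed_closedBall.preimage (f.continuous.iterate n)) ?_
  exact Set.iInter_subset (fun n : ℕ => (fun w : ℂ => f.eval w)^[n] ⁻¹' Metric.closedBall 0 R) 0

end Polynomial

theorem isBounded_range_iterate_apply_iff {α : Type*} [Bornology α] (f : α → α) (x : α) :
    Bornology.IsBounded (Set.range fun n : ℕ => f^[n] (f x)) ↔
      Bornology.IsBounded (Set.range fun n : ℕ => f^[n] x) := by
  have h : (Set.range fun n : ℕ => f^[n] x) = {x} ∪ Set.range fun n : ℕ => f^[n] (f x) := by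
    ext y
    simp only [Set.mem_range, Set.mem_union, Set.mem_singleton_iff]
    constructor
    · rintro ⟨_ | n, rfl⟩
      · exact Or.inl rfl
      · exact Or.inr ⟨n, rfl⟩
    · rintro (rfl | ⟨n, rfl⟩)
      · exact ⟨0, rfl⟩
      · exact ⟨n + 1, rfl⟩
  rw [h, Bornology.isBounded_union]
  simp

/-- For a complex polynomial of degree `≥ 2`, the image under `f` of the connected
component of the filled-in Julia set containing `x` is the connected component
containing `f(x)`. -/
theorem image_component_eq_component_image
    (f : Polynomial ℂ) (d : ℕ) (hd : 2 ≤ d) (hdeg : f.natDegree = d)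
    (Kf : Set ℂ)
    (hKf : Kf = {z : ℂ | Bornology.IsBounded
      (Set.range fun n : ℕ => (fun w : ℂ => f.eval w)^[n] z)}) :
    ∀ x ∈ Kf, (fun w : ℂ => f.eval w) '' connectedComponentIn Kf x =
      connectedComponentIn Kf (f.eval x) := by
  intro x hx
  have hdeg2 : 2 ≤ f.natDegree := hdeg ▸ hd
  have hpre : (fun w : ℂ => f.eval w) ⁻¹' Kf = Kf := by
    subst hKf
    exact Set.ext fun z => isBounded_range_iterate_apply_iff (fun w : ℂ => f.eval w) z
  have hcomp : IsCompact Kf := hKf ▸ Polynomial.isCompact_setOf_isBounded_range_iterate_eval hdeg2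
  have hfx : f.eval x ∈ Kf := by rwa [← hpre] at hx
  have h := (f.isOpenQuotientMap_eval (by omega)).isOpenMap.image_connectedComponentIn_preimage
    f.continuous (s := Kf) (by rwa [hpre]) hfx
  rwa [hpre] at h
end
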